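/- arXiv:1310.5788 — 3 statements merged into one kernel-verified Lean document; each statement's English description precedes it below -/
import Mathlib

section
/- For every k ≥ 3 and every edge e of the wheel W_k: if e is a rim edge, then W_k ∖ e has width 2; and if e is a spoke edge, then W_k / e has width 2. -/
/-!  Common definitions: multigraphs, separations, width, minors,
Kirchhoff/Dodgson polynomials, Feynman 5-splitting, enhanced graphs. -/

noncomputable section

attribute [local instance] Classical.propDecidable

/-- A finite multigraph, given by finite vertex and edge types together with
source and target maps (an arbitrary orientation of each edge). -/
structure Multigraph : Type 1 where
  V : Type
  E : Type
  [fintypeV : Fintype V]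
  [fintypeE : Fintype E]
  src : E → V
  tgt : E → V

attribute [instance] Multigraph.fintypeV Multigraph.fintypeE

namespace Multigraph

variable (G : Multigraph)

/-- The endpoints of an edge as an unordered pair. -/
def ends (e : G.E) : Sym2 G.V := s(G.src e, G.tgt e)

/-- Incidence of a vertex with an edge. -/
def inc (v : G.V) (e : G.E) : Prop := v = G.src e ∨ v = G.tgt e

/-- `V(G_A)`: the vertices of the subgraph induced by an edge set `A`. -/
def edgeVerts (A : Set G.E) : Set G.V := {v | ∃ e ∈ A, G.inc v e}

/-- The order of the separation `(A, Aᶜ)` of the graph `G`,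
i.e. `|V(G_A) ∩ V(G_B)|` where `B = Aᶜ`. -/
def sepOrder (A : Set G.E) : ℕ := (G.edgeVerts A ∩ G.edgeVerts Aᶜ).ncard

/-- One step along an edge belonging to the edge set `A`. -/
def stepOn (A : Set G.E) (a b : G.V) : Prop :=
  ∃ e ∈ A, (G.src e = a ∧ G.tgt e = b) ∨ (G.src e = b ∧ G.tgt e = a)

/-- Reachability using only edges in `A`. -/
def reachOn (A : Set G.E) : G.V → G.V → Prop := Relation.ReflTransGen (G.stepOn A)

/-- Adjacency. -/
def Adj (a b : G.V) : Prop := G.stepOn Set.univ a b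

/-- One adjacency step staying inside the vertex set `U`. -/
def stepWithin (U : Set G.V) (a b : G.V) : Prop := a ∈ U ∧ b ∈ U ∧ G.Adj a b

/-- The subgraph induced by the vertex set `U` is (nonempty and) connected. -/
def ConnectedWithin (U : Set G.V) : Prop :=
  U.Nonempty ∧ ∀ a ∈ U, ∀ b ∈ U, Relation.ReflTransGen (G.stepWithin U) a b

/-- Connectivity of the multigraph. -/
def Connected : Prop := G.ConnectedWithin Set.univ

/-- A multigraph is simple if it has no loops and no parallel edges. -/
def Simple : Prop := (∀ e : G.E, G.src e ≠ G.tgt e) ∧ Function.Injective G.ends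

/-- 3-connectivity: at least 4 vertices, and removing fewer than 3 vertices
leaves a connected graph. -/
def ThreeConnected : Prop :=
  4 ≤ Fintype.card G.V ∧ ∀ S : Set G.V, S.ncard < 3 → G.ConnectedWithin Sᶜ

/-- The spanning subgraph with edge set `T` is connected. -/
def ConnectedOn (T : Set G.E) : Prop := ∀ a b : G.V, G.reachOn T a b

/-- The degree of `v` in the spanning subgraph with edge set `T`
(loops count twice). -/
def degOn (T : Set G.E) (v : G.V) : ℕ :=
  ({e ∈ T | G.src e = v}).ncard + ({e ∈ T | G.tgt e = v}).ncard

/-- The degree of a vertex (loops count twice). -/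
def degree (v : G.V) : ℕ := G.degOn Set.univ v

/-- An edge set is a forest (contains no cycle) iff every nonempty subset
has a vertex of degree exactly one. -/
def IsForest (T : Set G.E) : Prop :=
  ∀ T' ⊆ T, T'.Nonempty → ∃ v : G.V, G.degOn T' v = 1

/-- `T` is the edge set of a spanning tree of `G`. -/
def IsSpanningTree (T : Set G.E) : Prop := G.IsForest T ∧ G.ConnectedOn T

/-- The rank of an edge set in the cycle matroid `M(G)`:
the size of a largest forest contained in it. -/
def rk (A : Set G.E) : ℕ := sSup {n | ∃ T ⊆ A, G.IsForest T ∧ T.ncard = n}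

/-- The order of the separation `(A, Aᶜ)` in the cycle matroid `M(G)`,
namely `r(A) + r(Aᶜ) - r(E) + 1`. -/
def msepOrder (A : Set G.E) : ℕ := G.rk A + G.rk Aᶜ + 1 - G.rk Set.univ

/-- The number of connected components of `G_A`, the subgraph induced by the
edge set `A`. -/
def ncompOn (A : Set G.E) : ℕ :=
  ({C : Set G.V | ∃ v ∈ G.edgeVerts A, C = {w | G.reachOn A v w}}).ncard

/-- `G` has an edge ordering of width at most `k`: every prefix/suffix
separation has order at most `k`. -/
def WidthLE (k : ℕ) : Prop :=
  ∃ f : Fin (Fintype.card G.E) ≃ G.E,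
    ∀ ℓ : ℕ,
      G.sepOrder {e | ∃ i : Fin (Fintype.card G.E), f i = e ∧ (i : ℕ) < ℓ} ≤ k

/-- The width of `G`: the minimum width of an edge ordering. -/
def width : ℕ := sInf {k | G.WidthLE k}

/-- The minor of `G` obtained by deleting the edges in `D` and contracting the
edges in `C`. -/
def minorDC (D C : Set G.E) : Multigraph :=
  let rel : G.V → G.V → Prop := fun a b => ∃ e ∈ C, G.src e = a ∧ G.tgt e = b
  { V := Quot rel
    E := {e : G.E // e ∉ D ∪ C}
    fintypeV := @Fintype.ofFinite _ (Finite.of_surjective (Quot.mk rel) fun q => Quot.exists_rep q)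
    fintypeE := Fintype.ofFinite _
    src := fun e => Quot.mk rel (G.src e.1)
    tgt := fun e => Quot.mk rel (G.tgt e.1) }

/-- Deletion of a vertex (together with all incident edges). -/
def deleteVertex (v : G.V) : Multigraph :=
  { V := {w : G.V // w ≠ v}
    E := {e : G.E // ¬ G.inc v e}
    fintypeV := Fintype.ofFinite _
    fintypeE := Fintype.ofFinite _
    src := fun e => ⟨G.src e.1, fun h => e.2 (Or.inl h.symm)⟩
    tgt := fun e => ⟨G.tgt e.1, fun h => e.2 (Or.inr h.symm)⟩ }

/-- The edges having one endpoint in `X` and the other in `Y`. -/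
def crossEdges (X Y : Set G.V) : Set G.E :=
  {e | (G.src e ∈ X ∧ G.tgt e ∈ Y) ∨ (G.src e ∈ Y ∧ G.tgt e ∈ X)}

/-- `G` has `R` as a minor, via branch sets. -/
def HasMinor (R : Multigraph) : Prop :=
  ∃ X : R.V → Set G.V,
    (∀ v : R.V, G.ConnectedWithin (X v)) ∧
    (Pairwise fun v w => Disjoint (X v) (X w)) ∧
    ∀ v w : R.V, v ≠ w →
      ({f : R.E | R.ends f = s(v, w)}).ncard ≤ (G.crossEdges (X v) (X w)).ncard

/-- `D` is the edge set of a cycle of `G`. -/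
def IsCycleSet (D : Set G.E) : Prop :=
  D.Nonempty ∧ (∀ v ∈ G.edgeVerts D, G.degOn D v = 2) ∧
    ∀ a ∈ G.edgeVerts D, ∀ b ∈ G.edgeVerts D, G.reachOn D a b

/-- The side `A` of a separation on `X` is rich: for every `x ∈ X` there is a
cycle `D` avoiding `x` with at most one edge outside `A`. -/
def Rich (A : Set G.E) (X : Set G.V) : Prop :=
  ∀ x ∈ X, ∃ D : Set G.E, G.IsCycleSet D ∧ x ∉ G.edgeVerts D ∧ (D \ A).ncard ≤ 1

/-- The entry of the (edge × vertex) incidence matrix, as a polynomial. -/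
def incCol (e : G.E) (v : G.V) : MvPolynomial G.E ℤ :=
  (if G.src e = v then 1 else 0) - (if G.tgt e = v then 1 else 0)

/-- The expanded Kirchhoff matrix `M_G` (with the column of `v0` deleted). -/
def bigMatrix (v0 : G.V) :
    Matrix (G.E ⊕ {v : G.V // v ≠ v0}) (G.E ⊕ {v : G.V // v ≠ v0}) (MvPolynomial G.E ℤ) :=
  Matrix.of fun r c =>
    match r, c with
    | Sum.inl e, Sum.inl f => if e = f then MvPolynomial.X e else 0
    | Sum.inl e, Sum.inr v => G.incCol e v.1
    | Sum.inr v, Sum.inl e => - G.incCol e v.1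
    | Sum.inr _, Sum.inr _ => 0

/-- The Dodgson polynomial `Ψ^{I,J}_K`: delete the rows indexed by `I` and the
columns indexed by `J` from `M_G`, take the determinant, and set `x_e = 0`
for `e ∈ K`.  (It is well defined up to an overall sign.) -/
def dodgson (v0 : G.V) (I J K : Set G.E) : MvPolynomial G.E ℤ :=
  if h : Nonempty ({e : G.E // e ∉ I} ≃ {e : G.E // e ∉ J}) then
    MvPolynomial.aeval (fun e => if e ∈ K then (0 : MvPolynomial G.E ℤ) else MvPolynomial.X e)
      (Matrix.det (Matrix.of fun r c =>
        G.bigMatrix v0 (Sum.map Subtype.val id r) (Sum.map (fun x => (h.some x).1) id c)))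
  else 0

/-- `(I,J,K)` is one of the 30 Dodgson configurations associated with the
5-configuration `S`. -/
def DodgsonConfig (S I J K : Set G.E) : Prop :=
  I ∪ J ∪ K = S ∧
    ((I.ncard = 2 ∧ J.ncard = 2 ∧ K.ncard = 1 ∧ I ∩ J = ∅ ∧ I ∩ K = ∅ ∧ J ∩ K = ∅) ∨
      (I.ncard = 3 ∧ J.ncard = 3 ∧ K = ∅ ∧ (I ∩ J).ncard = 1))

/-- The 5-configuration `S` splits: one of its 30 associated Dodgson
polynomials is identically zero. -/
def ConfigSplits (S : Set G.E) : Prop :=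
  ∃ I J K : Set G.E, G.DodgsonConfig S I J K ∧ ∀ v0 : G.V, G.dodgson v0 I J K = 0

/-- `G` is Feynman 5-split: every 5-configuration splits. -/
def FeynmanSplit : Prop := ∀ S : Set G.E, S.ncard = 5 → G.ConfigSplits S

/-- `(U, F)` is a subgraph of `G` (every edge of `F` has both ends in `U`). -/
def IsSubgraphPair (U : Set G.V) (F : Set G.E) : Prop :=
  ∀ e ∈ F, G.src e ∈ U ∧ G.tgt e ∈ U

/-- `G` decomposes into edge-disjoint subgraphs `G₁ ∪ G₂ = G` with
`|V(G₁) ∩ V(G₂)| ≤ 2` and `|E(G₁) ∩ S| = 2`, or with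
`|V(G₁) ∩ V(G₂)| = 1` and `|E(G₁) ∩ S| = 1`. -/
def splitWitness (S : Set G.E) : Prop :=
  ∃ (U1 U2 : Set G.V) (F1 F2 : Set G.E),
    G.IsSubgraphPair U1 F1 ∧ G.IsSubgraphPair U2 F2 ∧
    Disjoint F1 F2 ∧ U1 ∪ U2 = Set.univ ∧ F1 ∪ F2 = Set.univ ∧
    (((U1 ∩ U2).ncard ≤ 2 ∧ (F1 ∩ S).ncard = 2) ∨
      ((U1 ∩ U2).ncard = 1 ∧ (F1 ∩ S).ncard = 1))

/-- A separation of order at most 1 with edges of `S` on both sides, or a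
("bad") 2-separation with `min{|A ∩ S|, |B ∩ S|} = 2`. -/
def badSplitSep (S : Set G.E) : Prop :=
  ∃ A : Set G.E,
    (G.sepOrder A ≤ 1 ∧ (A ∩ S).Nonempty ∧ (Aᶜ ∩ S).Nonempty) ∨
      (G.sepOrder A = 2 ∧ min (A ∩ S).ncard (Aᶜ ∩ S).ncard = 2)

/-- Isomorphism of multigraphs. -/
def IsoTo (G' : Multigraph) : Prop :=
  ∃ (α : G.V ≃ G'.V) (β : G.E ≃ G'.E),
    ∀ e : G.E, G'.ends (β e) = Sym2.map α (G.ends e)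

/-- `G` is a tree. -/
def IsTree : Prop := G.Connected ∧ G.IsForest Set.univ

/-- Every vertex has degree 1 or 3. -/
def IsCubic : Prop := ∀ v : G.V, G.degree v = 1 ∨ G.degree v = 3

/-- A leaf. -/
def IsLeaf (v : G.V) : Prop := G.degree v = 1

/-- A cubic caterpillar: a cubic tree whose non-leaf vertices induce a path. -/
def IsCubicCaterpillar : Prop :=
  G.IsTree ∧ G.IsCubic ∧
    (∀ a ∈ {v : G.V | ¬ G.IsLeaf v}, ∀ b ∈ {v : G.V | ¬ G.IsLeaf v},
      Relation.ReflTransGen (G.stepWithin {v : G.V | ¬ G.IsLeaf v}) a b) ∧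
    ∀ v : G.V, ¬ G.IsLeaf v →
      ({e : G.E | G.inc v e ∧ ∃ w : G.V, ¬ G.IsLeaf w ∧ G.inc w e ∧ w ≠ v}).ncard ≤ 2

/-- The branch decomposition `(T, φ)` of the cycle matroid `M(G)` has width at
most `k`: removing any edge `f` of `T` gives a separation of the ground set
of matroid order at most `k`. -/
def branchWidthLE (T : Multigraph) (φ : G.E → T.V) (k : ℕ) : Prop :=
  ∀ f : T.E,
    G.msepOrder {e : G.E | φ e ∈ {x : T.V | T.reachOn {f}ᶜ (T.src f) x}} ≤ k

/-- `(T, φ)` is a branch decomposition of `M(G)` over a cubic caterpillar. -/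
def IsCatDecomp (T : Multigraph) (φ : G.E → T.V) : Prop :=
  T.IsCubicCaterpillar ∧ Function.Injective φ ∧ ∀ e : G.E, T.IsLeaf (φ e)

/-- The caterpillar width of the cycle matroid `M(G)`. -/
def catWidth : ℕ :=
  sInf {k | ∃ (T : Multigraph) (φ : G.E → T.V), G.IsCatDecomp T φ ∧ G.branchWidthLE T φ k}

end Multigraph

/-! ### Concrete graphs -/

/-- The complete graph `K₅`. -/
def K5m : Multigraph where
  V := Fin 5
  E := {p : Fin 5 × Fin 5 // p.1 < p.2}
  src := fun e => e.1.1
  tgt := fun e => e.1.2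

/-- The complete bipartite graph `K₃,₃`. -/
def K33m : Multigraph where
  V := Fin 3 ⊕ Fin 3
  E := Fin 3 × Fin 3
  src := fun e => Sum.inl e.1
  tgt := fun e => Sum.inr e.2

/-- The cube (3-dimensional hypercube) graph `C`. -/
def cubeM : Multigraph where
  V := Fin 2 × Fin 2 × Fin 2
  E := Fin 3 × Fin 2 × Fin 2
  src := fun e =>
    if e.1 = 0 then (0, e.2.1, e.2.2) else if e.1 = 1 then (e.2.1, 0, e.2.2)
      else (e.2.1, e.2.2, 0)
  tgt := fun e =>
    if e.1 = 0 then (1, e.2.1, e.2.2) else if e.1 = 1 then (e.2.1, 1, e.2.2)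
      else (e.2.1, e.2.2, 1)

/-- The octahedron graph `O = K₂,₂,₂`. -/
def octaM : Multigraph where
  V := Fin 3 × Fin 2
  E := {p : (Fin 3 × Fin 2) × (Fin 3 × Fin 2) // p.1.1 < p.2.1}
  src := fun e => e.1.1
  tgt := fun e => e.1.2

/-- The edges of the graph `H` (the cube after a Y–Δ transformation at one
vertex): vertices `0,1,2` form the new triangle, `6` is the antipodal vertex. -/
def hEdgeList : List (Fin 7 × Fin 7) :=
  [(0,1), (0,2), (1,2), (0,3), (0,4), (1,3), (1,5), (2,4), (2,5), (3,6), (4,6), (5,6)]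

/-- The graph `H`, one Δ–Y away from each of the cube and the octahedron. -/
def Hm : Multigraph where
  V := Fin 7
  E := {p : Fin 7 × Fin 7 // p ∈ hEdgeList}
  src := fun e => e.1.1
  tgt := fun e => e.1.2

/-- The complete graph `K₄`. -/
def K4m : Multigraph where
  V := Fin 4
  E := {p : Fin 4 × Fin 4 // p.1 < p.2}
  src := fun e => e.1.1
  tgt := fun e => e.1.2

/-- `K₅⁻`, the complete graph on 5 vertices minus the edge `{3,4}`. -/
def K5minusM : Multigraph where
  V := Fin 5
  E := {p : Fin 5 × Fin 5 // p.1 < p.2 ∧ ¬(p.1 = 3 ∧ p.2 = 4)}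
  src := fun e => e.1.1
  tgt := fun e => e.1.2

/-- The wheel `W_k`: centre `none`; rim edges `Sum.inl i` join `some i` to
`some (i+1)`, spoke edges `Sum.inr i` join the centre to `some i`. -/
def wheelM (k : ℕ) : Multigraph where
  V := Option (Fin k)
  E := Fin k ⊕ Fin k
  src := Sum.elim (fun i => some i) (fun _ => none)
  tgt := Sum.elim (fun i => some (finRotate k i)) (fun i => some i)

/-! ### Enhanced graphs -/

/-- An enhanced graph: a graph together with sets of contract-proof and
delete-proof edges. -/
structure EGraph : Type 1 where
  G : Multigraph
  Cp : Set G.E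
  Dp : Set G.E

namespace EGraph

/-- The 5-configuration `S` of an enhanced graph splits. -/
def Splits (H : EGraph) (S : Set H.G.E) : Prop :=
  H.G.badSplitSep S ∨
    (∃ f ∈ S \ H.Dp, (H.G.minorDC {f} ∅).badSplitSep {e | e.1 ∈ S}) ∨
    (∃ f ∈ S \ H.Cp, (H.G.minorDC ∅ {f}).badSplitSep {e | e.1 ∈ S})

/-- An enhanced graph is non-split if it has a non-split 5-configuration. -/
def NonSplit (H : EGraph) : Prop := ∃ S : Set H.G.E, S.ncard = 5 ∧ ¬ H.Splits S

/-- Deletion of an edge. -/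
def delE (H : EGraph) (f : H.G.E) : EGraph :=
  ⟨H.G.minorDC {f} ∅, {e | e.1 ∈ H.Cp}, {e | e.1 ∈ H.Dp}⟩

/-- Contraction of an edge. -/
def conE (H : EGraph) (f : H.G.E) : EGraph :=
  ⟨H.G.minorDC ∅ {f}, {e | e.1 ∈ H.Cp}, {e | e.1 ∈ H.Dp}⟩

/-- Deletion of a vertex. -/
def delV (H : EGraph) (v : H.G.V) : EGraph :=
  ⟨H.G.deleteVertex v, {e | e.1 ∈ H.Cp}, {e | e.1 ∈ H.Dp}⟩

/-- Remove an edge from the contract-proof set. -/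
def unprotC (H : EGraph) (f : H.G.E) : EGraph := ⟨H.G, H.Cp \ {f}, H.Dp⟩

/-- Remove an edge from the delete-proof set. -/
def unprotD (H : EGraph) (f : H.G.E) : EGraph := ⟨H.G, H.Cp, H.Dp \ {f}⟩

/-- Delete `f'` of a parallel pair `f, f'` and make `f` delete-proof. -/
def parallelReduce (H : EGraph) (f f' : H.G.E) : EGraph :=
  ⟨H.G.minorDC {f'} ∅, {e | e.1 ∈ H.Cp}, {e | e.1 ∈ H.Dp ∨ e.1 = f}⟩

/-- Contract `f'` of the two edges `f, f'` at a degree-two vertex and make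
`f` contract-proof. -/
def seriesReduce (H : EGraph) (f f' : H.G.E) : EGraph :=
  ⟨H.G.minorDC ∅ {f'}, {e | e.1 ∈ H.Cp ∨ e.1 = f}, {e | e.1 ∈ H.Dp}⟩

/-- One step of the enhanced-graph minor relation. -/
inductive MinorStep : EGraph → EGraph → Prop
  | delV (H : EGraph) (v : H.G.V) : MinorStep H (H.delV v)
  | delE (H : EGraph) (f : H.G.E) : MinorStep H (H.delE f)
  | conE (H : EGraph) (f : H.G.E) : MinorStep H (H.conE f)
  | unprotC (H : EGraph) (f : H.G.E) (hf : f ∈ H.Cp) : MinorStep H (H.unprotC f)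
  | unprotD (H : EGraph) (f : H.G.E) (hf : f ∈ H.Dp) : MinorStep H (H.unprotD f)
  | parallel (H : EGraph) (f f' : H.G.E) (hne : f ≠ f')
      (hpar : H.G.ends f = H.G.ends f') : MinorStep H (H.parallelReduce f f')
  | series (H : EGraph) (f f' : H.G.E) (v : H.G.V) (hne : f ≠ f')
      (hf : H.G.inc v f) (hf' : H.G.inc v f')
      (hdeg : ∀ e : H.G.E, H.G.inc v e → e = f ∨ e = f') :
      MinorStep H (H.seriesReduce f f')

/-- Minor-minimal non-split enhanced graph: non-split, but every proper
enhanced minor is split. -/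
def MinorMinimalNonSplit (H : EGraph) : Prop :=
  H.NonSplit ∧ ∀ H' : EGraph, Relation.TransGen MinorStep H H' → ¬ H'.NonSplit

/-- Isomorphism of enhanced graphs. -/
def IsoTo (H H' : EGraph) : Prop :=
  ∃ (α : H.G.V ≃ H'.G.V) (β : H.G.E ≃ H'.G.E),
    (∀ e : H.G.E, H'.G.ends (β e) = Sym2.map α (H.G.ends e)) ∧
    (∀ e : H.G.E, β e ∈ H'.Cp ↔ e ∈ H.Cp) ∧
    (∀ e : H.G.E, β e ∈ H'.Dp ↔ e ∈ H.Dp)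

end EGraph

/-- The edge `01` of `K₄`. -/
def e01K4 : K4m.E := ⟨(0, 1), by decide⟩

/-- The enhanced graph `K₄(1)`: all edges of `K₄` except one are both
contract-proof and delete-proof. -/
def K4one : EGraph := ⟨K4m, {e | e ≠ e01K4}, {e | e ≠ e01K4}⟩

/-! ### The statement -/

open Multigraph

namespace Multigraph

/-- An injective ranking of the edges all of whose initial segments have order at most `m`
witnesses width at most `m`. -/
theorem widthLE_of_injective_rank {G : Multigraph} {m : ℕ} (r : G.E → ℕ)
    (hr : Function.Injective r) (h : ∀ t, G.sepOrder {e | r e < t} ≤ m) : G.WidthLE m := by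
  let _ : LinearOrder G.E := LinearOrder.lift' r hr
  have hlt : ∀ a b : G.E, a < b ↔ r a < r b := fun a b => Iff.rfl
  let f : Fin (Fintype.card G.E) ≃o G.E := Fintype.orderIsoFinOfCardEq G.E rfl
  refine ⟨f.toEquiv, fun ℓ => ?_⟩
  by_cases hℓ : ℓ < Fintype.card G.E
  · convert h (r (f ⟨ℓ, hℓ⟩)) using 2
    ext e
    obtain ⟨i, rfl⟩ := f.surjective e
    simp only [Set.mem_ofPred_eq, ← hlt, f.lt_iff_lt]
    constructor
    · rintro ⟨j, hj, hjl⟩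
      rw [f.injective hj] at hjl
      exact hjl
    · exact fun hi => ⟨i, rfl, hi⟩
  · have huniv : {e | ∃ i : Fin (Fintype.card G.E), f.toEquiv i = e ∧ (i : ℕ) < ℓ} = Set.univ := by
      ext e
      obtain ⟨i, rfl⟩ := f.surjective e
      simp only [Set.mem_ofPred_eq, Set.mem_univ, iff_true]
      exact ⟨i, rfl, by omega⟩
    rw [huniv]
    simp [sepOrder, edgeVerts]

/-- A graph whose edges can be ranked along a path of positions, with every vertex other than a
common apex `c` having its own position, has width at most two. -/
theorem widthLE_two_of_positions {G : Multigraph} (r : G.E → ℕ) (hr : Function.Injective r)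
    (c : G.V) (q : G.V → ℕ) (hq : Set.InjOn q {c}ᶜ)
    (h : ∀ e v, G.inc v e → v = c ∨ (r e / 2 ≤ q v ∧ q v ≤ (r e + 1) / 2)) : G.WidthLE 2 := by
  refine widthLE_of_injective_rank r hr fun t => ?_
  have hmid : ∀ v ∈ G.edgeVerts {e | r e < t} ∩ G.edgeVerts {e | r e < t}ᶜ,
      v ≠ c → q v = t / 2 := by
    rintro v ⟨⟨e, he, hve⟩, e', he', hve'⟩ hv
    have h₁ := (h e v hve).resolve_left hv
    have h₂ := (h e' v hve').resolve_left hv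
    simp only [Set.mem_compl_iff, Set.mem_ofPred_eq, not_lt] at he he'
    omega
  by_cases hex : ∃ w, w ≠ c ∧ q w = t / 2
  · obtain ⟨w, hw, hqw⟩ := hex
    refine (Set.ncard_le_ncard (t := {c, w}) fun v hv => ?_).trans
      ((Set.ncard_insert_le c {w}).trans (by simp))
    by_cases hvc : v = c
    · exact Or.inl hvc
    · exact Or.inr (hq hvc hw ((hmid v hv hvc).trans hqw.symm))
  · refine (Set.ncard_le_ncard (t := {c}) fun v hv => ?_).trans (by simp)
    by_contra hvc
    exact hex ⟨v, hvc, hmid v hv hvc⟩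

/-- If some edge exists, no edge is a loop and both ends of every edge meet a further edge, then
the width is at least two. -/
theorem two_le_of_widthLE {G : Multigraph} [Nonempty G.E] (hloop : ∀ e, G.src e ≠ G.tgt e)
    (hsrc : ∀ e, ∃ e' ≠ e, G.inc (G.src e) e') (htgt : ∀ e, ∃ e' ≠ e, G.inc (G.tgt e) e')
    {m : ℕ} (h : G.WidthLE m) : 2 ≤ m := by
  obtain ⟨f, hf⟩ := h
  let e := f ⟨0, Fintype.card_pos⟩
  have hfirst : {x | ∃ i : Fin (Fintype.card G.E), f i = x ∧ (i : ℕ) < 1} = {e} := by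
    ext x
    constructor
    · rintro ⟨i, rfl, hi⟩
      exact congrArg f (Fin.ext (by simpa using hi))
    · rintro rfl
      exact ⟨_, rfl, Nat.zero_lt_one⟩
  have h₁ := hf 1
  rw [hfirst] at h₁
  refine le_trans ?_ h₁
  rw [← Set.ncard_pair (hloop e)]
  refine Set.ncard_le_ncard ?_
  rintro v (rfl | rfl)
  · obtain ⟨e', hne, hinc⟩ := hsrc e
    exact ⟨⟨e, rfl, Or.inl rfl⟩, e', hne, hinc⟩
  · obtain ⟨e', hne, hinc⟩ := htgt e
    exact ⟨⟨e, rfl, Or.inr rfl⟩, e', hne, hinc⟩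

theorem width_eq_two {G : Multigraph} (h : G.WidthLE 2) (hmin : ∀ m, G.WidthLE m → 2 ≤ m) :
    G.width = 2 :=
  le_antisymm (Nat.sInf_le h) (le_csInf ⟨2, h⟩ hmin)

end Multigraph

/-- The rank of an edge of the wheel in the ordering that alternates spokes and rim edges,
starting from the spoke at the rim vertex `s`. -/
def wheelRank {n : ℕ} (s : Fin (n + 1)) : Fin (n + 1) ⊕ Fin (n + 1) → ℕ :=
  Sum.elim (fun v => 2 * (v - s).val + 1) fun v => 2 * (v - s).val

theorem wheelRank_injective {n : ℕ} (s : Fin (n + 1)) : Function.Injective (wheelRank s) := by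
  have key : ∀ a b : Fin (n + 1), (a - s).val = (b - s).val → a = b := fun a b h =>
    sub_left_injective (Fin.ext h)
  rintro (a | a) (b | b) h <;> simp only [wheelRank, Sum.elim_inl, Sum.elim_inr] at h
  · rw [key a b (by omega)]
  · omega
  · omega
  · rw [key a b (by omega)]

/-- The position of a vertex of the wheel counted along the rim from `s`. -/
def wheelPos {n : ℕ} (s : Fin (n + 1)) : Option (Fin (n + 1)) → ℕ :=
  fun x => x.elim 0 fun v => (v - s).val

theorem val_add_one_sub {n : ℕ} (s v : Fin (n + 1)) (h : v + 1 ≠ s) :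
    (v + 1 - s).val = (v - s).val + 1 := by
  rw [show v + 1 - s = (v - s) + 1 by abel]
  refine Fin.val_add_one_of_lt' ?_
  have hne : v - s ≠ Fin.last n := fun hl => h <| by
    have h0 : v - s + 1 = 0 := by rw [hl, Fin.last_add_one]
    rw [show v - s + 1 = v + 1 - s by abel] at h0
    exact sub_eq_zero.mp h0
  have := Fin.val_lt_last hne
  omega

/-- A minor of the wheel has width at most two if the vertex relation identifies at most the
rim vertex `s` with the centre, and the rim edge entering `s` is deleted or `s` is identified with
the centre. -/
theorem wheel_minor_widthLE_two {n : ℕ} (s : Fin (n + 1))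
    (D C : Set (Fin (n + 1) ⊕ Fin (n + 1))) (hC : C ⊆ {Sum.inr s})
    (hDC : ∀ v, v + 1 = s → Sum.inl v ∉ D → Sum.inr s ∈ C) :
    ((wheelM (n + 1)).minorDC D C).WidthLE 2 := by
  refine Multigraph.widthLE_two_of_positions (fun e => wheelRank s e.1)
    ((wheelRank_injective s).comp Subtype.val_injective) (Quot.mk _ none)
    (Quot.lift (wheelPos s) ?_) ?_ ?_
  · rintro a b ⟨e, he, rfl, rfl⟩
    obtain rfl := hC he
    simp [wheelM, wheelPos]
  · rintro ⟨_ | a⟩ ha ⟨_ | b⟩ hb h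
    · rfl
    · exact absurd rfl ha
    · exact absurd rfl hb
    · have hab : a = b := sub_left_injective (Fin.ext h)
      rw [hab]
  · rintro ⟨v | v, he⟩ x (rfl | rfl)
    · right
      change (2 * (v - s).val + 1) / 2 ≤ (v - s).val ∧ (v - s).val ≤ (2 * (v - s).val + 1 + 1) / 2
      omega
    · by_cases hv : v + 1 = s
      · left
        refine (Quot.sound ⟨Sum.inr s, hDC v hv fun hD => he (Or.inl hD), rfl, ?_⟩).symm
        simp [wheelM, hv]
      · right
        change (2 * (v - s).val + 1) / 2 ≤ wheelPos s (some (finRotate (n + 1) v)) ∧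
          wheelPos s (some (finRotate (n + 1) v)) ≤ (2 * (v - s).val + 1 + 1) / 2
        have hpos : wheelPos s (some (finRotate (n + 1) v)) = (v - s).val + 1 := by
          simpa [wheelPos] using val_add_one_sub s v hv
        omega
    · exact Or.inl rfl
    · right
      change 2 * (v - s).val / 2 ≤ (v - s).val ∧ (v - s).val ≤ (2 * (v - s).val + 1) / 2
      omega

/-- A map of the vertices that respects the contracted edges and separates the ends of
each remaining edge shows that the minor is loopless. -/
theorem minorDC_loopless {G : Multigraph} {α : Type*} (D C : Set G.E) (g : G.V → α)
    (hC : ∀ e ∈ C, g (G.src e) = g (G.tgt e)) (hg : ∀ e ∉ D ∪ C, g (G.src e) ≠ g (G.tgt e))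
    (e : (G.minorDC D C).E) : (G.minorDC D C).src e ≠ (G.minorDC D C).tgt e := by
  intro h
  refine hg e.1 e.2 (congrArg (Quot.lift g ?_) h)
  rintro _ _ ⟨e', he', rfl, rfl⟩
  exact hC e' he'

theorem wheel_delete_rim_two_le {n : ℕ} (i : Fin (n + 3)) {m : ℕ}
    (h : ((wheelM (n + 3)).minorDC {Sum.inl i} ∅).WidthLE m) : 2 ≤ m := by
  have hspoke : ∀ a : Fin (n + 3), (Sum.inr a : Fin (n + 3) ⊕ Fin (n + 3)) ∉
      ({Sum.inl i} ∪ ∅ : Set (Fin (n + 3) ⊕ Fin (n + 3))) := by simp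
  have hrim : ∀ a : Fin (n + 3), a ≠ i → (Sum.inl a : Fin (n + 3) ⊕ Fin (n + 3)) ∉
      ({Sum.inl i} ∪ ∅ : Set (Fin (n + 3) ⊕ Fin (n + 3))) := by simp
  have hsucc : ∀ a : Fin (n + 3), a + 1 ≠ a := by simp
  have _ : Nonempty ((wheelM (n + 3)).minorDC {Sum.inl i} ∅).E := ⟨⟨Sum.inr i, hspoke i⟩⟩
  refine Multigraph.two_le_of_widthLE (minorDC_loopless _ _ id (by simp) ?_) ?_ ?_ h
  · rintro (a | a) - <;> simp [wheelM]
  · rintro ⟨a | a, ha⟩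
    · exact ⟨⟨Sum.inr a, hspoke a⟩, fun h => Sum.inr_ne_inl (congrArg Subtype.val h), Or.inr rfl⟩
    · exact ⟨⟨Sum.inr (a + 1), hspoke _⟩,
        fun h => hsucc a (Sum.inr_injective (congrArg Subtype.val h)), Or.inl rfl⟩
  · rintro ⟨a | a, ha⟩
    · exact ⟨⟨Sum.inr (finRotate _ a), hspoke _⟩,
        fun h => Sum.inr_ne_inl (congrArg Subtype.val h), Or.inr rfl⟩
    · by_cases hai : a = i
      · refine ⟨⟨Sum.inl (a - 1), hrim _ ?_⟩,
          fun h => Sum.inl_ne_inr (congrArg Subtype.val h), Or.inr ?_⟩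
        · simp [hai]
        · simp [Multigraph.minorDC, wheelM]
      · exact ⟨⟨Sum.inl a, hrim a hai⟩, fun h => Sum.inl_ne_inr (congrArg Subtype.val h), Or.inl rfl⟩

theorem wheel_contract_spoke_two_le {n : ℕ} (i : Fin (n + 3)) {m : ℕ}
    (h : ((wheelM (n + 3)).minorDC ∅ {Sum.inr i}).WidthLE m) : 2 ≤ m := by
  have hrim : ∀ a : Fin (n + 3), (Sum.inl a : Fin (n + 3) ⊕ Fin (n + 3)) ∉
      (∅ ∪ {Sum.inr i} : Set (Fin (n + 3) ⊕ Fin (n + 3))) := by simp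
  have hsucc : ∀ a : Fin (n + 3), a + 1 ≠ a := by simp
  have hpred : ∀ a : Fin (n + 3), a - 1 ≠ a := by simp
  have _ : Nonempty ((wheelM (n + 3)).minorDC ∅ {Sum.inr i}).E := ⟨⟨Sum.inl i, hrim i⟩⟩
  refine Multigraph.two_le_of_widthLE
    (minorDC_loopless _ _ (fun x => if x = some i then none else x) ?_ ?_) ?_ ?_ h
  · rintro _ rfl
    simp [wheelM]
  · rintro (a | a) ha
    · simp only [wheelM, Sum.elim_inl, finRotate_apply, Option.some.injEq]
      split_ifs with h₁ h₂ <;> simp_all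
    · have hai : a ≠ i := fun hai => ha (Or.inr (congrArg Sum.inr hai))
      simp [wheelM, hai]
  · rintro ⟨a | a, ha⟩
    · refine ⟨⟨Sum.inl (a - 1), hrim _⟩,
        fun h => hpred a (Sum.inl_injective (congrArg Subtype.val h)), Or.inr ?_⟩
      simp [Multigraph.minorDC, wheelM]
    · exact ⟨⟨Sum.inl i, hrim i⟩, fun h => Sum.inl_ne_inr (congrArg Subtype.val h),
        Or.inl (Quot.sound ⟨Sum.inr i, rfl, rfl, rfl⟩)⟩
  · rintro ⟨a | a, ha⟩
    · exact ⟨⟨Sum.inl (a + 1), hrim _⟩,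
        fun h => hsucc a (Sum.inl_injective (congrArg Subtype.val h)),
        Or.inl (by simp [Multigraph.minorDC, wheelM])⟩
    · exact ⟨⟨Sum.inl a, hrim a⟩, fun h => Sum.inl_ne_inr (congrArg Subtype.val h), Or.inl rfl⟩

theorem stmt16 (k : ℕ) (hk : 3 ≤ k) :
    (∀ i : Fin k, ((wheelM k).minorDC {Sum.inl i} ∅).width = 2) ∧
    (∀ i : Fin k, ((wheelM k).minorDC ∅ {Sum.inr i}).width = 2) := by
  obtain ⟨n, rfl⟩ := Nat.exists_eq_add_of_le' hk
  refine ⟨fun i => width_eq_two ?_ fun m => wheel_delete_rim_two_le i,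
    fun i => width_eq_two ?_ fun m => wheel_contract_spoke_two_le i⟩
  · refine wheel_minor_widthLE_two (i + 1) _ _ (Set.empty_subset _) fun v hv hD => ?_
    exact absurd (congrArg Sum.inl (add_right_cancel hv)) hD
  · exact wheel_minor_widthLE_two i _ _ subset_rfl fun _ _ _ => rfl
end
end

section
/- Let k ≥ 4 and let G̃ be an enhanced graph whose underlying graph is the wheel W_k with centre vertex w, and let S̃ be a 5-configuration of G̃. Then S̃ is non-split if and only if all of the following hold: (1) every rim edge in S̃ is delete-proof; (2) every spoke edge in S̃ is contract-proof; (3) if v is a non-centre vertex and all edges incident with v lie in S̃, then the spoke vw is delete-proof; (4) if the three edges vw, v'w, vv' all lie in S̃, then the rim edge vv' is contract-proof. -/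
/-!  Common definitions: multigraphs, separations, width, minors,
Kirchhoff/Dodgson polynomials, Feynman 5-splitting, enhanced graphs. -/

noncomputable section

attribute [local instance] Classical.propDecidable

/-! ### The statement -/

open Multigraph

namespace Multigraph

variable {G : Multigraph}

/-- The common vertices of the two sides of the separation `(A, Aᶜ)`. -/
def boundary (G : Multigraph) (A : Set G.E) : Set G.V := G.edgeVerts A ∩ G.edgeVerts Aᶜ

lemma boundary_compl (A : Set G.E) : G.boundary Aᶜ = G.boundary A := by
  simp [boundary, Set.inter_comm]

lemma mem_boundary {A : Set G.E} {v : G.V} {e e' : G.E} (he : e ∈ A) (he' : e' ∉ A)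
    (hv : G.inc v e) (hv' : G.inc v e') : v ∈ G.boundary A :=
  ⟨⟨e, he, hv⟩, e', he', hv'⟩

lemma mem_iff_of_notMem_boundary {A : Set G.E} {v : G.V} {e e' : G.E} (h : v ∉ G.boundary A)
    (hv : G.inc v e) (hv' : G.inc v e') : e ∈ A ↔ e' ∈ A := by
  by_contra hne
  by_cases he : e ∈ A
  · exact h (mem_boundary he (fun he' => hne (by simp [he, he'])) hv hv')
  · exact h (mem_boundary (by_contra fun he' => hne (by simp [he, he'])) he hv' hv)

lemma eq_or_eq_of_sepOrder_le_two {A : Set G.E} (hA : G.sepOrder A ≤ 2) {u v w : G.V}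
    (hu : u ∈ G.boundary A) (hv : v ∈ G.boundary A) (hw : w ∈ G.boundary A) :
    u = v ∨ u = w ∨ v = w := by
  by_contra! h
  have : 2 < (G.boundary A).ncard :=
    (Set.two_lt_ncard_iff (Set.toFinite _)).2 ⟨u, v, w, hu, hv, hw, h.1, h.2.1, h.2.2⟩
  exact absurd hA (not_le.2 this)

lemma eq_of_sepOrder_le_one {A : Set G.E} (hA : G.sepOrder A ≤ 1) {u v : G.V}
    (hu : u ∈ G.boundary A) (hv : v ∈ G.boundary A) : u = v := by
  by_contra h
  have : 1 < (G.boundary A).ncard :=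
    (Set.one_lt_ncard_iff (Set.toFinite _)).2 ⟨u, v, hu, hv, h⟩
  exact absurd hA (not_le.2 this)

lemma sepOrder_le_two {A : Set G.E} (x y : G.V)
    (h : ∀ v ∈ G.boundary A, v = x ∨ v = y) : G.sepOrder A ≤ 2 :=
  (Set.ncard_le_ncard (t := {x, y}) (fun v hv => h v hv) (Set.toFinite _)).trans
    (by simpa using Set.ncard_insert_le x {y})

/-- A separation of order at most two dividing four distinguished edges evenly is bad. -/
lemma badSplitSep_of_ncard_eq_two {S A : Set G.E} (hS : S.ncard = 4) (hA : G.sepOrder A ≤ 2)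
    (hAS : (A ∩ S).ncard = 2) : G.badSplitSep S := by
  have hsum : (S ∩ A).ncard + (S \ A).ncard = S.ncard :=
    Set.ncard_inter_add_ncard_sdiff_eq_ncard S A (Set.toFinite _)
  have hc : (Aᶜ ∩ S).ncard = 2 := by
    rw [Set.inter_comm, ← Set.sdiff_eq]
    rw [Set.inter_comm] at hsum
    omega
  refine ⟨A, ?_⟩
  rcases hA.lt_or_eq with h | h
  · refine Or.inl ⟨by omega, ?_, ?_⟩ <;> apply Set.nonempty_of_ncard_ne_zero <;> omega
  · exact Or.inr ⟨h, by omega⟩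

/-- If the edges can be listed so that away from `w` the edges at the `t`-th vertex occupy only
positions `2t - 1`, `2t`, `2t + 1`, then any four edges are divided evenly by a separation of
order at most two. -/
lemma badSplitSep_of_linear_order {I : Type*} {S : Set G.E} (hS : S.ncard = 4) (w : G.V)
    (p : I → G.V) (t : I → ℕ) (ht : Function.Injective t) (f : G.E → ℕ)
    (hf : Function.Injective f)
    (hV : ∀ v, v = w ∨ ∃ i, v = p i ∧ ∀ e, G.inc v e → 2 * t i ≤ f e + 1 ∧ f e ≤ 2 * t i + 1) :
    G.badSplitSep S := by
  have hord : ∀ n, G.sepOrder {e | f e < n} ≤ 2 := by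
    intro n
    have key : ∀ v ∈ G.boundary {e | f e < n}, v = w ∨ ∃ i, v = p i ∧ t i = n / 2 := by
      rintro v ⟨⟨e, he, hve⟩, e', he', hve'⟩
      rcases hV v with h | ⟨i, h, hi⟩
      · exact Or.inl h
      · refine Or.inr ⟨i, h, ?_⟩
        have h1 := hi e hve
        have h2 := hi e' hve'
        simp only [Set.mem_ofPred_eq, Set.mem_compl_iff] at he he'
        omega
    by_cases hc : ∃ i, t i = n / 2
    · obtain ⟨c, hc⟩ := hc
      refine sepOrder_le_two w (p c) fun v hv => (key v hv).imp_right ?_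
      rintro ⟨i, rfl, hi⟩
      rw [ht (hi.trans hc.symm)]
    · refine sepOrder_le_two w w fun v hv => (key v hv).imp_right ?_
      rintro ⟨i, -, hi⟩
      exact absurd ⟨i, hi⟩ hc
  have hex : ∃ n, 2 ≤ ({e | f e < n} ∩ S).ncard := by
    obtain ⟨N, hN⟩ := (Set.finite_range f).bddAbove
    refine ⟨N + 1, ?_⟩
    have : {e | f e < N + 1} ∩ S = S :=
      Set.inter_eq_right.2 fun e _ => Nat.lt_succ_of_le (hN ⟨e, rfl⟩)
    rw [this]
    omega
  obtain ⟨n, hn, hmin⟩ : ∃ n, 2 ≤ ({e | f e < n} ∩ S).ncard ∧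
      ∀ m < n, ({e | f e < m} ∩ S).ncard < 2 :=
    ⟨Nat.find hex, Nat.find_spec hex, fun m hm => not_le.1 (Nat.find_min hex hm)⟩
  refine badSplitSep_of_ncard_eq_two hS (hord n) (le_antisymm ?_ hn)
  cases n with
  | zero => simp at hn
  | succ n =>
    have hsub : ({e | f e < n + 1} ∩ S) ⊆ ({e | f e < n} ∩ S) ∪ {e | f e = n} := by
      rintro e ⟨he, heS⟩
      rcases Nat.lt_succ_iff_lt_or_eq.1 he with h | h
      · exact Or.inl ⟨h, heS⟩
      · exact Or.inr h
    have h1 : ({e | f e = n} : Set G.E).ncard ≤ 1 :=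
      (Set.ncard_le_one (Set.toFinite _)).2 fun a ha b hb => hf (ha.trans hb.symm)
    have h2 := (Set.ncard_le_ncard hsub (Set.toFinite _)).trans (Set.ncard_union_le _ _)
    have h3 := hmin n (Nat.lt_succ_self n)
    omega

/-- A presentation of a graph as a wheel in which a rim vertex may carry any number
of spokes: the rim vertices are indexed by `I`, and `rim i` joins `rimV i` to `rimV (next i)`. -/
structure WheelLike (G : Multigraph) (I : Type) where
  next : I → I
  centre : G.V
  rimV : I → G.V
  rim : I → G.E
  spokes : I → Set G.E
  cyclic : ∀ (P : I → Prop) (i₀ : I), P i₀ → (∀ i, P i → P (next i)) → ∀ i, P i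
  rimV_injective : Function.Injective rimV
  inc_rim : ∀ i, G.inc (rimV i) (rim i)
  inc_next_rim : ∀ i, G.inc (rimV (next i)) (rim i)
  inc_centre_spoke : ∀ i, ∀ e ∈ spokes i, G.inc centre e
  inc_spoke : ∀ i, ∀ e ∈ spokes i, G.inc (rimV i) e
  rimV_ne_centre : ∀ i, rimV i ≠ centre
  cover : ∀ e, (∃ i, e = rim i) ∨ ∃ i, e ∈ spokes i
  next_next_ne : ∀ i, next (next i) ≠ i

namespace WheelLike

variable {I : Type} (W : G.WheelLike I)

lemma next_surjective : Function.Surjective W.next := fun i =>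
  W.cyclic (fun i => ∃ j, W.next j = i) (W.next i) ⟨i, rfl⟩ (fun j _ => ⟨j, rfl⟩) i

lemma next_injective : Function.Injective W.next := by
  have : Finite I := Finite.of_injective _ W.rimV_injective
  exact Finite.injective_iff_surjective.2 W.next_surjective

lemma next_ne (i : I) : W.next i ≠ i := fun h => W.next_next_ne i (by rw [h, h])

/-- If only one rim vertex may lie on the boundary, then one side of the separation consists of
spokes at that vertex. -/
lemma exists_side_subset_spokes {A : Set G.E} (i₀ : I)
    (h : ∀ i, i ≠ i₀ → W.rimV i ∉ G.boundary A) :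
    ∃ O, (O = A ∨ O = Aᶜ) ∧ (∀ i, W.rim i ∉ O) ∧ O ⊆ W.spokes i₀ := by
  have hrim : ∀ i, (W.rim i ∈ A ↔ W.rim i₀ ∈ A) := by
    refine W.cyclic _ i₀ Iff.rfl fun i hi => ?_
    by_cases hn : W.next i = i₀
    · rw [hn]
    · rw [← hi]
      exact mem_iff_of_notMem_boundary (h _ hn) (W.inc_rim _) (W.inc_next_rim _)
  have hspoke : ∀ i, i ≠ i₀ → ∀ e ∈ W.spokes i, (e ∈ A ↔ W.rim i₀ ∈ A) := fun i hi e he =>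
    (mem_iff_of_notMem_boundary (h i hi) (W.inc_spoke i e he) (W.inc_rim i)).trans (hrim i)
  have hsub : ∀ e, ¬ (e ∈ A ↔ W.rim i₀ ∈ A) → e ∈ W.spokes i₀ := by
    intro e he
    rcases W.cover e with ⟨i, rfl⟩ | ⟨i, hi⟩
    · exact absurd (hrim i) he
    · by_cases hi0 : i = i₀
      · exact hi0 ▸ hi
      · exact absurd (hspoke i hi0 e hi) he
  by_cases h0 : W.rim i₀ ∈ A
  · refine ⟨Aᶜ, Or.inr rfl, fun i hi => hi ((hrim i).2 h0), fun e he => hsub e fun h => ?_⟩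
    exact he (h.2 h0)
  · refine ⟨A, Or.inl rfl, fun i hi => h0 ((hrim i).1 hi), fun e he => hsub e fun h => ?_⟩
    exact h0 (h.1 he)

/-- If the centre is not on the boundary, then one side of the separation contains no spokes. -/
lemma exists_side_without_spokes {A : Set G.E} (h : W.centre ∉ G.boundary A) :
    ∃ O, (O = A ∨ O = Aᶜ) ∧ ∀ i, ∀ e ∈ W.spokes i, e ∉ O := by
  by_cases hA : ∀ i, ∀ e ∈ W.spokes i, e ∉ A
  · exact ⟨A, Or.inl rfl, hA⟩
  · push Not at hA
    obtain ⟨j, f, hf, hfA⟩ := hA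
    refine ⟨Aᶜ, Or.inr rfl, fun i e he heA => heA ?_⟩
    exact (mem_iff_of_notMem_boundary h (W.inc_centre_spoke i e he)
      (W.inc_centre_spoke j f hf)).2 hfA

/-- A side without spokes of a separation of order at most two consists of at most one rim edge,
or of the two rim edges at a vertex without spokes. -/
lemma side_without_spokes {O : Set G.E} (hO : G.sepOrder O ≤ 2)
    (hsp : ∀ i, ∀ e ∈ W.spokes i, e ∉ O)
    (huniq : ∀ i j, W.spokes i = ∅ → W.spokes j = ∅ → i = j)
    (hlong : ∀ i, W.spokes i = ∅ → W.next (W.next (W.next i)) ≠ i) :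
    (O.Subsingleton ∧ (G.sepOrder O ≤ 1 → O = ∅)) ∨
      ∃ j, W.spokes (W.next j) = ∅ ∧ O ⊆ {W.rim j, W.rim (W.next j)} ∧ ¬ G.sepOrder O ≤ 1 := by
  have hOrim : ∀ e ∈ O, ∃ i, e = W.rim i := fun e he =>
    (W.cover e).resolve_right fun ⟨i, hi⟩ => hsp i e hi he
  have hspoked : ∀ i e, e ∈ O → G.inc (W.rimV i) e → W.spokes i ≠ ∅ →
      W.rimV i ∈ G.boundary O := by
    intro i e he hi hne
    obtain ⟨s, hs⟩ := Set.nonempty_iff_ne_empty.2 hne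
    exact mem_boundary he (hsp i s hs) hi (W.inc_spoke i s hs)
  by_cases hex : ∃ j, W.spokes (W.next j) = ∅ ∧ W.rim j ∈ O ∧ W.rim (W.next j) ∈ O
  · obtain ⟨j, hj, h1, h2⟩ := hex
    have hb1 : W.rimV j ∈ G.boundary O := hspoked j _ h1 (W.inc_rim j) fun h =>
      W.next_ne j (huniq _ _ hj h)
    have hb2 : W.rimV (W.next (W.next j)) ∈ G.boundary O :=
      hspoked _ _ h2 (W.inc_next_rim _) fun h => W.next_ne _ (huniq _ _ h hj)
    refine Or.inr ⟨j, hj, fun e he => ?_, fun hle => ?_⟩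
    · obtain ⟨i, rfl⟩ := hOrim e he
      by_contra hne
      have hij : i ≠ j := fun h => hne (by simp [h])
      have hinj : i ≠ W.next j := fun h => hne (by simp [h])
      have hb3 : W.rimV i ∈ G.boundary O := hspoked _ _ he (W.inc_rim _) fun h =>
        hinj (huniq _ _ h hj)
      have hb4 : W.rimV (W.next i) ∈ G.boundary O := hspoked _ _ he (W.inc_next_rim _) fun h =>
        hij (W.next_injective (huniq _ _ h hj))
      have hi : i = W.next (W.next j) := by
        rcases eq_or_eq_of_sepOrder_le_two hO hb1 hb2 hb3 with h | h | h
        · exact absurd (W.rimV_injective h).symm (W.next_next_ne j)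
        · exact absurd (W.rimV_injective h).symm hij
        · exact (W.rimV_injective h).symm
      rcases eq_or_eq_of_sepOrder_le_two hO hb1 hb2 hb4 with h | h | h
      · exact W.next_next_ne j (W.rimV_injective h).symm
      · have h' := W.rimV_injective h
        exact hlong _ hj (by rw [← hi, ← h'])
      · have h' := W.rimV_injective h
        rw [← hi] at h'
        exact W.next_ne i h'.symm
    · exact W.next_next_ne j (W.rimV_injective (eq_of_sepOrder_le_one hle hb1 hb2)).symm
  · have hends : ∀ i, W.rim i ∈ O → W.rimV i ∈ G.boundary O ∧
        W.rimV (W.next i) ∈ G.boundary O := by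
      intro i hi
      constructor
      · by_cases hs : W.spokes i = ∅
        · obtain ⟨l, rfl⟩ := W.next_surjective i
          exact mem_boundary hi (fun h => hex ⟨l, hs, h, hi⟩) (W.inc_rim _) (W.inc_next_rim _)
        · exact hspoked _ _ hi (W.inc_rim _) hs
      · by_cases hs : W.spokes (W.next i) = ∅
        · exact mem_boundary hi (fun h => hex ⟨i, hs, hi, h⟩) (W.inc_next_rim _) (W.inc_rim _)
        · exact hspoked _ _ hi (W.inc_next_rim _) hs
    refine Or.inl ⟨fun e he e' he' => ?_, fun hle => ?_⟩
    · obtain ⟨i, rfl⟩ := hOrim e he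
      obtain ⟨j, rfl⟩ := hOrim e' he'
      by_contra hne
      have hij : i ≠ j := fun h => hne (by rw [h])
      obtain ⟨hi1, hi2⟩ := hends i he
      obtain ⟨hj1, hj2⟩ := hends j he'
      have hj : j = W.next i := by
        rcases eq_or_eq_of_sepOrder_le_two hO hi1 hi2 hj1 with h | h | h
        · exact absurd (W.rimV_injective h).symm (W.next_ne i)
        · exact absurd (W.rimV_injective h) hij
        · exact (W.rimV_injective h).symm
      rcases eq_or_eq_of_sepOrder_le_two hO hi1 hi2 hj2 with h | h | h
      · exact W.next_ne i (W.rimV_injective h).symm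
      · exact W.next_next_ne i (by rw [← hj]; exact (W.rimV_injective h).symm)
      · exact hij (W.next_injective (W.rimV_injective h))
    · by_contra hne
      obtain ⟨e, he⟩ := Set.nonempty_iff_ne_empty.2 hne
      obtain ⟨i, rfl⟩ := hOrim e he
      obtain ⟨hi1, hi2⟩ := hends i he
      exact W.next_ne i (W.rimV_injective (eq_of_sepOrder_le_one hle hi1 hi2)).symm

lemma exists_small_side {S A : Set G.E} (hA : G.sepOrder A ≤ 2)
    (huniq : ∀ i j, W.spokes i = ∅ → W.spokes j = ∅ → i = j)
    (hlong : ∀ i, W.spokes i = ∅ → W.next (W.next (W.next i)) ≠ i)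
    (hspokes : ∀ i, (W.spokes i ∩ S).Subsingleton)
    (hrims : ∀ j, W.spokes (W.next j) = ∅ → W.rim j ∈ S → W.rim (W.next j) ∉ S) :
    ∃ O, (O = A ∨ O = Aᶜ) ∧ (O ∩ S).Subsingleton ∧ (G.sepOrder A ≤ 1 → O = ∅) := by
  by_cases hc : W.centre ∈ G.boundary A
  · have hother : ∀ i j, W.rimV i ∈ G.boundary A → W.rimV j ∈ G.boundary A → i = j := by
      intro i j hi hj
      rcases eq_or_eq_of_sepOrder_le_two hA hc hi hj with h | h | h
      · exact absurd h.symm (W.rimV_ne_centre i)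
      · exact absurd h.symm (W.rimV_ne_centre j)
      · exact W.rimV_injective h
    by_cases hex : ∃ i, W.rimV i ∈ G.boundary A
    · obtain ⟨i₀, hi₀⟩ := hex
      obtain ⟨O, hO, -, hsub⟩ :=
        W.exists_side_subset_spokes i₀ fun i hi hb => hi (hother i i₀ hb hi₀)
      exact ⟨O, hO, (hspokes i₀).anti (Set.inter_subset_inter_left S hsub), fun hle =>
        absurd (eq_of_sepOrder_le_one hle hi₀ hc) (W.rimV_ne_centre i₀)⟩
    · push Not at hex
      obtain ⟨⟨e, he, -⟩, e', he', -⟩ := hc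
      obtain ⟨i₀⟩ : Nonempty I := by
        rcases W.cover e with ⟨i, -⟩ | ⟨i, -⟩ <;> exact ⟨i⟩
      obtain ⟨O, hO, hrim, hsub⟩ := W.exists_side_subset_spokes i₀ fun i _ => hex i
      have hempty : O = ∅ := by
        by_contra hne
        obtain ⟨s, hs⟩ := Set.nonempty_iff_ne_empty.2 hne
        have hb := mem_boundary hs (hrim i₀) (W.inc_spoke i₀ s (hsub hs)) (W.inc_rim i₀)
        rcases hO with rfl | rfl
        · exact hex i₀ hb
        · exact hex i₀ (boundary_compl A ▸ hb)
      exact ⟨O, hO, by simp [hempty], fun _ => hempty⟩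
  · obtain ⟨O, hO, hsp⟩ := W.exists_side_without_spokes hc
    have hord : G.sepOrder O = G.sepOrder A := by
      rcases hO with rfl | rfl
      · rfl
      · exact congrArg Set.ncard (boundary_compl A)
    refine ⟨O, hO, ?_⟩
    rw [← hord] at hA ⊢
    rcases W.side_without_spokes hA hsp huniq hlong with ⟨h1, h2⟩ | ⟨j, hj, hsub, h2⟩
    · exact ⟨h1.anti Set.inter_subset_left, h2⟩
    · refine ⟨?_, fun hle => absurd hle h2⟩
      have := hrims j hj
      rintro a ⟨ha, haS⟩ b ⟨hb, hbS⟩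
      rcases hsub ha with rfl | rfl <;> rcases hsub hb with rfl | rfl
      · rfl
      · exact absurd hbS (this haS)
      · exact absurd haS (this hbS)
      · rfl

theorem not_badSplitSep {S : Set G.E}
    (huniq : ∀ i j, W.spokes i = ∅ → W.spokes j = ∅ → i = j)
    (hlong : ∀ i, W.spokes i = ∅ → W.next (W.next (W.next i)) ≠ i)
    (hspokes : ∀ i, (W.spokes i ∩ S).Subsingleton)
    (hrims : ∀ j, W.spokes (W.next j) = ∅ → W.rim j ∈ S → W.rim (W.next j) ∉ S) :
    ¬ G.badSplitSep S := by
  rintro ⟨A, ⟨hle, hne, hne'⟩ | ⟨hle, hmin⟩⟩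
  · obtain ⟨O, hO, -, hempty⟩ :=
      W.exists_small_side (S := S) (hle.trans one_le_two) huniq hlong hspokes hrims
    have := hempty hle
    rcases hO with rfl | rfl
    · simp [this] at hne
    · simp [this] at hne'
  · obtain ⟨O, hO, hsub, -⟩ :=
      W.exists_small_side (S := S) hle.le huniq hlong hspokes hrims
    have := (Set.ncard_le_one (Set.toFinite _)).2 hsub
    rcases hO with rfl | rfl <;> omega

end WheelLike

end Multigraph

/-! ### The cyclic order of the rim -/

lemma exists_rim_position {k : ℕ} (j : Fin k) :
    ∃ t : Fin k → ℕ, Function.Injective t ∧ t j = 0 ∧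
      ∀ i, finRotate k i ≠ j → t (finRotate k i) = t i + 1 := by
  cases k with
  | zero => exact j.elim0
  | succ n =>
    refine ⟨fun i => (i - j).val, fun a b h => ?_, by simp, fun i hi => ?_⟩
    · exact sub_left_injective (Fin.ext h)
    · rw [finRotate_apply] at hi ⊢
      have hne : i - j ≠ Fin.last n := by
        intro h
        apply hi
        have h1 : i - j + 1 = 0 := by rw [h, Fin.last_add_one]
        exact sub_eq_zero.1 (by rw [← h1]; abel)
      have h2 : i + 1 - j = i - j + 1 := by abel
      simp only [h2]
      rw [Fin.val_add_one, if_neg hne]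

lemma finRotate_cyclic {k : ℕ} (P : Fin k → Prop) (i₀ : Fin k) (h₀ : P i₀)
    (h : ∀ i, P i → P (finRotate k i)) (i : Fin k) : P i := by
  obtain ⟨t, ht, ht0, hstep⟩ := exists_rim_position i₀
  suffices H : ∀ n i, t i = n → P i from H _ i rfl
  intro n
  induction n with
  | zero => exact fun i hi => ht (hi.trans ht0.symm) ▸ h₀
  | succ n ih =>
    intro i hi
    obtain ⟨l, rfl⟩ := (finRotate k).surjective i
    have hl := hstep l fun hl => by rw [hl] at hi; omega
    exact h l (ih l (by omega))

lemma finRotate_ne_self {k : ℕ} (hk : 4 ≤ k) (i : Fin k) : finRotate k i ≠ i := by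
  obtain ⟨n, rfl⟩ := Nat.exists_eq_add_of_le' hk
  rw [finRotate_apply]
  intro h
  simp at h

lemma finRotate_finRotate_ne_self {k : ℕ} (hk : 4 ≤ k) (i : Fin k) :
    finRotate k (finRotate k i) ≠ i := by
  obtain ⟨n, rfl⟩ := Nat.exists_eq_add_of_le' hk
  rw [finRotate_apply, finRotate_apply, add_assoc]
  intro h
  simp [Fin.ext_iff, Fin.val_add, Nat.mod_eq_of_lt (show 2 < n + 3 + 1 by omega)] at h

lemma finRotate_finRotate_finRotate_ne_self {k : ℕ} (hk : 4 ≤ k) (i : Fin k) :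
    finRotate k (finRotate k (finRotate k i)) ≠ i := by
  obtain ⟨n, rfl⟩ := Nat.exists_eq_add_of_le' hk
  rw [finRotate_apply, finRotate_apply, finRotate_apply, add_assoc, add_assoc]
  intro h
  simp [Fin.ext_iff, Fin.val_add, Nat.mod_eq_of_lt (show 3 < n + 3 + 1 by omega)] at h

/-! ### Incidence in wheels and their minors -/

namespace Multigraph

/-- The vertex of a minor of `G` containing a given vertex of `G`. -/
def minorMk (G : Multigraph) (D C : Set G.E) (v : G.V) : (G.minorDC D C).V := Quot.mk _ v

section Minor

variable {G : Multigraph} {D C : Set G.E}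

lemma exists_minorMk (q : (G.minorDC D C).V) : ∃ v, q = G.minorMk D C v :=
  (Quot.exists_rep q).imp fun _ h => h.symm

lemma minorMk_src_eq_tgt {e : G.E} (he : e ∈ C) :
    G.minorMk D C (G.src e) = G.minorMk D C (G.tgt e) := Quot.sound ⟨e, he, rfl, rfl⟩

lemma eq_of_minorMk_eq {α : Type*} (φ : G.V → α) (hφ : ∀ e ∈ C, φ (G.src e) = φ (G.tgt e))
    {a b : G.V} (h : G.minorMk D C a = G.minorMk D C b) : φ a = φ b := by
  refine congrArg (Quot.lift φ ?_) h
  rintro _ _ ⟨e, he, rfl, rfl⟩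
  exact hφ e he

lemma minorMk_injective : Function.Injective (G.minorMk D ∅) := fun _ _ h =>
  eq_of_minorMk_eq id (by simp) h

lemma exists_inc_of_minor_inc {q : (G.minorDC D C).V} {e : (G.minorDC D C).E}
    (h : (G.minorDC D C).inc q e) : ∃ v, G.inc v e.1 ∧ q = G.minorMk D C v := by
  rcases h with h | h
  · exact ⟨_, Or.inl rfl, h⟩
  · exact ⟨_, Or.inr rfl, h⟩

lemma inc_of_minorMk_inc {v : G.V} {e : (G.minorDC D ∅).E}
    (h : (G.minorDC D ∅).inc (G.minorMk D ∅ v) e) : G.inc v e.1 := by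
  obtain ⟨u, hu, huv⟩ := exists_inc_of_minor_inc h
  rwa [minorMk_injective huv]

lemma ncard_minor {S : Set G.E} {f : G.E} (hf : f ∈ S) (hDC : D ∪ C = {f}) :
    ({e | e.1 ∈ S} : Set (G.minorDC D C).E).ncard + 1 = S.ncard := by
  have himage : (Subtype.val : {e : G.E // e ∉ D ∪ C} → G.E) '' {e | e.1 ∈ S} = S \ {f} := by
    ext e
    simp [hDC, and_comm]
  rw [← Set.ncard_sdiff_singleton_add_one hf, ← himage,
    Set.ncard_image_of_injective _ Subtype.val_injective]
  rfl

end Minor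

variable {k : ℕ}

lemma wheelM_inc_rim {v : (wheelM k).V} {i : Fin k} :
    (wheelM k).inc v (Sum.inl i) ↔ v = some i ∨ v = some (finRotate k i) := Iff.rfl

lemma wheelM_inc_spoke {v : (wheelM k).V} {i : Fin k} :
    (wheelM k).inc v (Sum.inr i) ↔ v = none ∨ v = some i := Iff.rfl

lemma wheelM_minorMk_rim (j : Fin k) :
    minorMk (wheelM k) ∅ {Sum.inl j} (some j) =
      minorMk (wheelM k) ∅ {Sum.inl j} (some (finRotate k j)) :=
  minorMk_src_eq_tgt (G := wheelM k) (e := Sum.inl j) rfl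

lemma wheelM_minorMk_spoke (j : Fin k) :
    minorMk (wheelM k) ∅ {Sum.inr j} none = minorMk (wheelM k) ∅ {Sum.inr j} (some j) :=
  minorMk_src_eq_tgt (G := wheelM k) (e := Sum.inr j) rfl

/-- The wheel itself. -/
def wheelLike (hk : 4 ≤ k) : (wheelM k).WheelLike (Fin k) where
  next := finRotate k
  centre := none
  rimV := some
  rim := Sum.inl
  spokes i := {Sum.inr i}
  cyclic := finRotate_cyclic
  rimV_injective := Option.some_injective _
  inc_rim _ := Or.inl rfl
  inc_next_rim _ := Or.inr rfl
  inc_centre_spoke := by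
    rintro i _ rfl
    exact Or.inl rfl
  inc_spoke := by
    rintro i _ rfl
    exact Or.inr rfl
  rimV_ne_centre _ := Option.some_ne_none _
  cover := by
    rintro (i | i)
    · exact Or.inl ⟨i, rfl⟩
    · exact Or.inr ⟨i, rfl⟩
  next_next_ne := finRotate_finRotate_ne_self hk

/-- The wheel with the spoke at `j` deleted. -/
def wheelLikeDelete (hk : 4 ≤ k) (j : Fin k) :
    ((wheelM k).minorDC {Sum.inr j} ∅).WheelLike (Fin k) where
  next := finRotate k
  centre := minorMk _ _ _ none
  rimV i := minorMk _ _ _ (some i)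
  rim i := ⟨Sum.inl i, by rintro (h | h) <;> cases h⟩
  spokes i := {e | e.1 = Sum.inr i}
  cyclic := finRotate_cyclic
  rimV_injective a b h := Option.some_injective _ (minorMk_injective h)
  inc_rim _ := Or.inl rfl
  inc_next_rim _ := Or.inr rfl
  inc_centre_spoke := by
    rintro i ⟨_, _⟩ rfl
    exact Or.inl rfl
  inc_spoke := by
    rintro i ⟨_, _⟩ rfl
    exact Or.inr rfl
  rimV_ne_centre _ h := Option.some_ne_none _ (minorMk_injective h)
  cover := by
    rintro ⟨i | i, h⟩
    · exact Or.inl ⟨i, rfl⟩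
    · exact Or.inr ⟨i, rfl⟩
  next_next_ne := finRotate_finRotate_ne_self hk

/-- The wheel with the rim edge from `j` contracted; the merged vertex is represented by the
successor of `j`. -/
def wheelLikeContract (hk : 4 ≤ k) (j : Fin k) :
    ((wheelM k).minorDC ∅ {Sum.inl j}).WheelLike {i : Fin k // i ≠ j} where
  next i := if h : finRotate k i.1 = j then ⟨finRotate k j, finRotate_ne_self hk j⟩
    else ⟨finRotate k i.1, h⟩
  centre := minorMk _ _ _ none
  rimV i := minorMk _ _ _ (some i.1)
  rim i := ⟨Sum.inl i.1, by rintro (h | h); exacts [h.elim, i.2 (Sum.inl_injective h)]⟩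
  spokes i := {e | e.1 = Sum.inr i.1 ∨ i.1 = finRotate k j ∧ e.1 = Sum.inr j}
  cyclic P i₀ h₀ h i := by
    have hj := finRotate_ne_self hk j
    have H : ∀ i : Fin k, (if hi : i = j then P ⟨finRotate k j, hj⟩ else P ⟨i, hi⟩) := by
      refine finRotate_cyclic _ i₀.1 (by rw [dif_neg i₀.2]; exact h₀) fun i hi => ?_
      by_cases hij : i = j
      · subst hij
        rw [dif_pos rfl] at hi
        rwa [dif_neg hj]
      · rw [dif_neg hij] at hi
        have := h _ hi
        by_cases hn : finRotate k i = j
        · rw [dif_pos hn] at this ⊢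
          exact this
        · rw [dif_neg hn] at this ⊢
          exact this
    have := H i.1
    rwa [dif_neg i.2] at this
  rimV_injective a b h := by
    have := eq_of_minorMk_eq
      (fun v : Option (Fin k) => if v = some j then some (finRotate k j) else v) (by
        rintro _ rfl
        simp [wheelM]) h
    simp only [Option.some.injEq, a.2, b.2, if_false] at this
    exact Subtype.ext this
  inc_rim _ := Or.inl rfl
  inc_next_rim i := by
    by_cases h : finRotate k i.1 = j
    · refine Or.inr ?_
      simp only [h, dif_pos]
      refine (wheelM_minorMk_rim j).symm.trans ?_
      exact congrArg (fun x => minorMk (wheelM k) ∅ {Sum.inl j} (some x)) h.symm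
    · simp only [h, dif_neg, not_false_eq_true]
      exact Or.inr rfl
  inc_centre_spoke := by
    rintro i ⟨_, _⟩ (rfl | ⟨-, rfl⟩) <;> exact Or.inl rfl
  inc_spoke := by
    rintro i ⟨_, _⟩ (rfl | ⟨hi, rfl⟩)
    · exact Or.inr rfl
    · refine Or.inr ?_
      rw [hi]
      exact (wheelM_minorMk_rim j).symm
  rimV_ne_centre i h := by
    have := eq_of_minorMk_eq (fun v : Option (Fin k) => v.isSome) (by
        rintro _ rfl
        simp [wheelM]) h
    simp at this
  cover := by
    rintro ⟨i | i, h⟩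
    · exact Or.inl ⟨⟨i, fun hi => h (Or.inr (congrArg _ hi))⟩, rfl⟩
    · by_cases hi : i = j
      · exact Or.inr ⟨⟨finRotate k j, finRotate_ne_self hk j⟩, Or.inr ⟨rfl, congrArg _ hi⟩⟩
      · exact Or.inr ⟨⟨i, hi⟩, Or.inl rfl⟩
  next_next_ne i := by
    have h2 := finRotate_finRotate_ne_self hk
    have h3 := finRotate_finRotate_finRotate_ne_self hk i.1
    intro h
    have h := congrArg Subtype.val h
    by_cases h1 : finRotate k i.1 = j
    · have h4 : finRotate k (finRotate k j) ≠ j := h2 j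
      simp only [h1, dite_true, h4, dite_false] at h
      exact h3 (by rw [h1, h])
    · simp only [h1, dite_false] at h
      by_cases h4 : finRotate k (finRotate k i.1) = j
      · simp only [h4, dite_true] at h
        exact h3 (by rw [h4, h])
      · simp only [h4, dite_false] at h
        exact h2 _ h

lemma wheelM_not_badSplitSep (hk : 4 ≤ k) (S : Set (wheelM k).E) :
    ¬ (wheelM k).badSplitSep S := by
  have hne : ∀ i, (wheelLike hk).spokes i ≠ ∅ := fun i => Set.singleton_ne_empty _
  exact (wheelLike hk).not_badSplitSep (fun i _ hi => absurd hi (hne i))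
    (fun i hi => absurd hi (hne i))
    (fun i => Set.subsingleton_singleton.anti Set.inter_subset_left)
    (fun i hi => absurd hi (hne _))

lemma wheelM_delete_spoke_not_badSplitSep (hk : 4 ≤ k) {S : Set (wheelM k).E} (j : Fin k)
    (h : ∀ i, finRotate k i = j → Sum.inl i ∈ S → Sum.inl j ∉ S) :
    ¬ ((wheelM k).minorDC {Sum.inr j} ∅).badSplitSep {e | e.1 ∈ S} := by
  have hne : ∀ i, (wheelLikeDelete hk j).spokes i = ∅ → i = j := by
    intro i hi
    by_contra hij
    refine (Set.eq_empty_iff_forall_notMem.1 hi) ⟨Sum.inr i, ?_⟩ rfl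
    rintro (h | h)
    · exact hij (Sum.inr_injective h)
    · exact h
  refine (wheelLikeDelete hk j).not_badSplitSep
    (fun i i' hi hi' => (hne i hi).trans (hne i' hi').symm)
    (fun i _ => finRotate_finRotate_finRotate_ne_self hk i) ?_ ?_
  · rintro i a ⟨ha, -⟩ b ⟨hb, -⟩
    exact Subtype.ext (ha.trans hb.symm)
  · intro i hi hS hS'
    have hij : finRotate k i = j := hne _ hi
    refine h i hij hS ?_
    rw [← hij]
    exact hS'

lemma wheelM_contract_rim_not_badSplitSep (hk : 4 ≤ k) {S : Set (wheelM k).E} (j : Fin k)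
    (h : Sum.inr j ∈ S → Sum.inr (finRotate k j) ∉ S) :
    ¬ ((wheelM k).minorDC ∅ {Sum.inl j}).badSplitSep {e | e.1 ∈ S} := by
  have hne : ∀ i, (wheelLikeContract hk j).spokes i ≠ ∅ := by
    intro i hi
    refine (Set.eq_empty_iff_forall_notMem.1 hi) ⟨Sum.inr i.1, ?_⟩ (Or.inl rfl)
    rintro (h | h) <;> cases h
  refine (wheelLikeContract hk j).not_badSplitSep (fun i _ hi => absurd hi (hne i))
    (fun i hi => absurd hi (hne i)) ?_ (fun i hi => absurd hi (hne _))
  rintro i ⟨a, ha'⟩ ⟨ha, haS⟩ ⟨b, hb'⟩ ⟨hb, hbS⟩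
  apply Subtype.ext
  rcases ha with ha | ⟨hi, ha⟩ <;> rcases hb with hb | ⟨hi', hb⟩ <;>
    simp only at ha hb <;> subst ha <;> subst hb
  · rfl
  · exact absurd (hi' ▸ haS) (h hbS)
  · exact absurd (hi ▸ hbS) (h haS)
  · rfl

lemma wheelM_delete_rim_badSplitSep {S : Set (wheelM k).E} (hS : S.ncard = 5) {j : Fin k}
    (hj : Sum.inl j ∈ S) : ((wheelM k).minorDC {Sum.inl j} ∅).badSplitSep {e | e.1 ∈ S} := by
  have hcard := ncard_minor (G := wheelM k) (D := {Sum.inl j}) (C := ∅) hj (Set.union_empty _)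
  obtain ⟨t, ht, -, hstep⟩ := exists_rim_position (finRotate k j)
  refine badSplitSep_of_linear_order (by omega) (minorMk _ _ _ none)
    (fun i => minorMk _ _ _ (some i)) t ht
    (fun e => Sum.elim (fun i => 2 * t i + 1) (fun i => 2 * t i) e.1) ?_ ?_
  · rintro ⟨a | a, ha⟩ ⟨b | b, hb⟩ h <;> simp only [Sum.elim_inl, Sum.elim_inr] at h
    · obtain rfl := ht (show t a = t b by omega)
      rfl
    · omega
    · omega
    · obtain rfl := ht (show t a = t b by omega)
      rfl
  · intro v
    obtain ⟨_ | i, rfl⟩ := exists_minorMk v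
    · exact Or.inl rfl
    · refine Or.inr ⟨i, rfl, fun e he => ?_⟩
      have hinc := inc_of_minorMk_inc he
      obtain ⟨a | a, ha⟩ := e
      · rcases wheelM_inc_rim.1 hinc with h | h <;> obtain rfl := Option.some_injective _ h
        · simp only [Sum.elim_inl]
          omega
        · have := hstep a fun haj =>
            ha (Or.inl (congrArg Sum.inl ((finRotate k).injective haj)))
          simp only [Sum.elim_inl]
          omega
      · obtain rfl := Option.some_injective _
          ((wheelM_inc_spoke.1 hinc).resolve_left (Option.some_ne_none _))
        simp only [Sum.elim_inr]
        omega

lemma wheelM_contract_spoke_badSplitSep {S : Set (wheelM k).E} (hS : S.ncard = 5) {j : Fin k}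
    (hj : Sum.inr j ∈ S) : ((wheelM k).minorDC ∅ {Sum.inr j}).badSplitSep {e | e.1 ∈ S} := by
  have hcard := ncard_minor (G := wheelM k) (D := ∅) (C := {Sum.inr j}) hj (Set.empty_union _)
  obtain ⟨t, ht, -, hstep⟩ := exists_rim_position j
  refine badSplitSep_of_linear_order (by omega) (minorMk _ _ _ none)
    (fun i => minorMk _ _ _ (some i)) t ht
    (fun e => Sum.elim (fun i => 2 * t i + 1) (fun i => 2 * t i) e.1) ?_ ?_
  · rintro ⟨a | a, ha⟩ ⟨b | b, hb⟩ h <;> simp only [Sum.elim_inl, Sum.elim_inr] at h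
    · obtain rfl := ht (show t a = t b by omega)
      rfl
    · omega
    · omega
    · obtain rfl := ht (show t a = t b by omega)
      rfl
  · intro v
    obtain ⟨_ | i, rfl⟩ := exists_minorMk v
    · exact Or.inl rfl
    by_cases hij : i = j
    · subst hij
      exact Or.inl (wheelM_minorMk_spoke i).symm
    · refine Or.inr ⟨i, rfl, fun e he => ?_⟩
      obtain ⟨u, hinc, hu⟩ := exists_inc_of_minor_inc he
      have hui : u = some i := by
        refine (eq_of_minorMk_eq (fun v : Option (Fin k) => v = some i) ?_ hu).mp rfl
        rintro _ rfl
        simp [wheelM, Ne.symm hij]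
      subst hui
      obtain ⟨a | a, ha⟩ := e
      · rcases wheelM_inc_rim.1 hinc with h | h <;> obtain rfl := Option.some_injective _ h
        · simp only [Sum.elim_inl]
          omega
        · have := hstep a hij
          simp only [Sum.elim_inl]
          omega
      · obtain rfl := Option.some_injective _
          ((wheelM_inc_spoke.1 hinc).resolve_left (Option.some_ne_none _))
        simp only [Sum.elim_inr]
        omega

lemma wheelM_delete_spoke_badSplitSep (hk : 4 ≤ k) {S : Set (wheelM k).E} (hS : S.ncard = 5)
    {j : Fin k} (hj : {e | (wheelM k).inc (some j) e} ⊆ S) :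
    ((wheelM k).minorDC {Sum.inr j} ∅).badSplitSep {e | e.1 ∈ S} := by
  have hjS : Sum.inr j ∈ S := hj (Or.inr rfl)
  have hcard := ncard_minor (G := wheelM k) (D := {Sum.inr j}) (C := ∅) hjS (Set.union_empty _)
  obtain ⟨l, rfl⟩ := (finRotate k).surjective j
  let r : Fin k → ((wheelM k).minorDC {Sum.inr (finRotate k l)} ∅).E := fun i =>
    ⟨Sum.inl i, by rintro (h | h) <;> cases h⟩
  refine badSplitSep_of_ncard_eq_two (A := {r l, r (finRotate k l)}) (by omega)
    (sepOrder_le_two (minorMk _ _ _ (some l))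
      (minorMk _ _ _ (some (finRotate k (finRotate k l)))) ?_) ?_
  · rintro v ⟨⟨e, he, hve⟩, e', he', hve'⟩
    have hmid : v ≠ minorMk _ _ _ (some (finRotate k l)) := by
      rintro rfl
      have hinc := inc_of_minorMk_inc hve'
      obtain ⟨a | a, ha⟩ := e'
      · apply he'
        rcases wheelM_inc_rim.1 hinc with h | h
        · obtain rfl := Option.some_injective _ h
          exact Or.inr rfl
        · obtain rfl := (finRotate k).injective (Option.some_injective _ h)
          exact Or.inl rfl
      · obtain rfl := Option.some_injective _
          ((wheelM_inc_spoke.1 hinc).resolve_left (Option.some_ne_none _))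
        exact ha (Or.inl rfl)
    rcases he with rfl | rfl <;> rcases hve with h | h
    · exact Or.inl h
    · exact absurd h hmid
    · exact absurd h hmid
    · exact Or.inr h
  · have hsub : {r l, r (finRotate k l)} ⊆
        ({e | e.1 ∈ S} : Set ((wheelM k).minorDC {Sum.inr (finRotate k l)} ∅).E) := by
      rintro _ (rfl | rfl)
      · exact hj (Or.inr rfl)
      · exact hj (Or.inl rfl)
    rw [Set.inter_eq_left.2 hsub]
    refine Set.ncard_pair fun h => finRotate_ne_self hk l ?_
    exact (Sum.inl_injective (congrArg Subtype.val h)).symm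

lemma wheelM_contract_rim_badSplitSep (hk : 4 ≤ k) {S : Set (wheelM k).E} (hS : S.ncard = 5)
    {j : Fin k} (hj : Sum.inr j ∈ S) (hj' : Sum.inr (finRotate k j) ∈ S)
    (hr : Sum.inl j ∈ S) :
    ((wheelM k).minorDC ∅ {Sum.inl j}).badSplitSep {e | e.1 ∈ S} := by
  have hcard := ncard_minor (G := wheelM k) (D := ∅) (C := {Sum.inl j}) hr (Set.empty_union _)
  let s : Fin k → ((wheelM k).minorDC ∅ {Sum.inl j}).E := fun i =>
    ⟨Sum.inr i, by rintro (h | h) <;> cases h⟩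
  refine badSplitSep_of_ncard_eq_two (A := {s j, s (finRotate k j)}) (by omega)
    (sepOrder_le_two (minorMk _ _ _ none) (minorMk _ _ _ (some j)) ?_) ?_
  · rintro v ⟨⟨e, he, hve⟩, -⟩
    rcases he with rfl | rfl <;> rcases hve with h | h
    · exact Or.inl h
    · exact Or.inr h
    · exact Or.inl h
    · exact Or.inr (h.trans (wheelM_minorMk_rim j).symm)
  · have hsub : {s j, s (finRotate k j)} ⊆
        ({e | e.1 ∈ S} : Set ((wheelM k).minorDC ∅ {Sum.inl j}).E) := by
      rintro _ (rfl | rfl)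
      · exact hj
      · exact hj'
    rw [Set.inter_eq_left.2 hsub]
    refine Set.ncard_pair fun h => finRotate_ne_self hk j ?_
    exact (Sum.inr_injective (congrArg Subtype.val h)).symm

end Multigraph

theorem stmt18 (k : ℕ) (hk : 4 ≤ k) (Cp Dp : Set (wheelM k).E)
    (S : Set (wheelM k).E) (hS : S.ncard = 5) :
    ¬ (EGraph.mk (wheelM k) Cp Dp).Splits S ↔
      ((∀ i : Fin k, Sum.inl i ∈ S → Sum.inl i ∈ Dp) ∧
        (∀ i : Fin k, Sum.inr i ∈ S → Sum.inr i ∈ Cp) ∧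
        (∀ i : Fin k, {e | (wheelM k).inc (some i) e} ⊆ S → Sum.inr i ∈ Dp) ∧
        (∀ i : Fin k, Sum.inr i ∈ S → Sum.inr (finRotate k i) ∈ S →
          Sum.inl i ∈ S → Sum.inl i ∈ Cp)) := by
  constructor
  · intro h
    refine ⟨fun i hi => ?_, fun i hi => ?_, fun i hi => ?_, fun i hi hi' hr => ?_⟩ <;>
      by_contra hne <;> apply h
    · exact Or.inr (Or.inl ⟨_, ⟨hi, hne⟩, wheelM_delete_rim_badSplitSep hS hi⟩)
    · exact Or.inr (Or.inr ⟨_, ⟨hi, hne⟩, wheelM_contract_spoke_badSplitSep hS hi⟩)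
    · exact Or.inr (Or.inl ⟨_, ⟨hi (Or.inr rfl), hne⟩,
        wheelM_delete_spoke_badSplitSep hk hS hi⟩)
    · exact Or.inr (Or.inr ⟨_, ⟨hr, hne⟩, wheelM_contract_rim_badSplitSep hk hS hi hi' hr⟩)
  · rintro ⟨h1, h2, h3, h4⟩ (h | ⟨f | f, ⟨hfS, hf⟩, h⟩ | ⟨f | f, ⟨hfS, hf⟩, h⟩)
    · exact wheelM_not_badSplitSep hk S h
    · exact hf (h1 f hfS)
    · refine wheelM_delete_spoke_not_badSplitSep hk f (fun i hif hi hfi => hf (h3 f ?_)) h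
      rintro (a | a) ha
      · rcases wheelM_inc_rim.1 ha with h | h
        · obtain rfl := Option.some_injective _ h
          exact hfi
        · obtain rfl := (finRotate k).injective (hif.trans (Option.some_injective _ h))
          exact hi
      · obtain rfl := Option.some_injective _
          ((wheelM_inc_spoke.1 ha).resolve_left (Option.some_ne_none _))
        exact hfS
    · exact wheelM_contract_rim_not_badSplitSep hk f
        (fun hi hi' => hf (h4 f hi hi' hfS)) h
    · exact hf (h2 f hfS)
end
end

section
/- Let G̃ be an enhanced graph whose underlying graph is K_5^- and let S̃ be a 5-configuration of G̃. Then S̃ is non-split if and only if all of the following hold: (1) every equatorial edge in S̃ is contract-proof; (2) every longitudinal edge contained in a triangle all of whose edges lie in S̃ is contract-proof; (3) whenever uv ∈ S̃ is a longitudinal edge with deg(u) = 3 such that the unique triangle of K_5^- containing u but not the edge uv has at least two edges in S̃, the edge uv is delete-proof. -/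
/-!  Common definitions: multigraphs, separations, width, minors,
Kirchhoff/Dodgson polynomials, Feynman 5-splitting, enhanced graphs. -/

noncomputable section

attribute [local instance] Classical.propDecidable

/-! ### The statement -/

open Multigraph

/-! ### Edge sets of `K₅⁻` as bit masks -/

namespace K5minus

section Masks

/- These instances must take precedence over `Classical.propDecidable` for `decide` to work. -/
attribute [local instance] Fintype.decidableForallFintype Fintype.decidableExistsFintype
  instDecidableAnd instDecidableOr instDecidableNot instDecidableForall instDecidableIff
  instDecidableEqBool instDecidableEqNat Nat.decLt Nat.decLe instDecidableEqFin
  Subtype.instDecidableEq instDecidableEqProd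

/-- The smaller endpoint of the `i`-th edge of `K₅⁻`. -/
def lo (i : Fin 9) : Fin 5 := (![0, 0, 0, 0, 1, 1, 1, 2, 2] : Fin 9 → Fin 5) i

/-- The larger endpoint of the `i`-th edge of `K₅⁻`. -/
def hi (i : Fin 9) : Fin 5 := (![1, 2, 3, 4, 2, 3, 4, 3, 4] : Fin 9 → Fin 5) i

theorem lo_lt_hi : ∀ i : Fin 9, lo i < hi i ∧ ¬ (lo i = 3 ∧ hi i = 4) := by decide +kernel

/-- The `i`-th edge of `K₅⁻`, in lexicographic order. -/
def edge (i : Fin 9) : K5minusM.E :=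
  ⟨(lo i, hi i), lo_lt_hi i⟩

theorem edge_injective : Function.Injective edge := by
  have h : ∀ i j : Fin 9, (lo i, hi i) = (lo j, hi j) → i = j := by decide +kernel
  exact fun i j hij => h i j (congrArg Subtype.val hij)

theorem edge_surjective : Function.Surjective edge := by
  have h : ∀ a b : Fin 5, (a < b ∧ ¬ (a = 3 ∧ b = 4)) → ∃ i : Fin 9, lo i = a ∧ hi i = b := by
    decide +kernel
  rintro ⟨⟨a, b⟩, hab⟩
  obtain ⟨i, rfl, rfl⟩ := h a b hab
  exact ⟨i, rfl⟩

/-- The index of an edge of `K₅⁻`. -/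
def idx (e : K5minusM.E) : Fin 9 := (edge_surjective e).choose

@[simp] theorem edge_idx (e : K5minusM.E) : edge (idx e) = e := (edge_surjective e).choose_spec

@[simp] theorem idx_edge (i : Fin 9) : idx (edge i) = i := edge_injective (edge_idx _)

theorem idx_injective : Function.Injective idx := Function.LeftInverse.injective edge_idx

theorem src_eq (e : K5minusM.E) : K5minusM.src e = lo (idx e) := by
  conv_lhs => rw [← edge_idx e]
  rfl

theorem tgt_eq (e : K5minusM.E) : K5minusM.tgt e = hi (idx e) := by
  conv_lhs => rw [← edge_idx e]
  rfl

/-- The number of bits of `n` set among the first `m`. -/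
def pop (m n : ℕ) : ℕ :=
  Nat.rec (motive := fun _ => ℕ) 0 (fun i acc => Nat.add (Nat.land (Nat.shiftRight n i) 1) acc) m

theorem pop_eq_count (m n : ℕ) : pop m n = Nat.count (fun i => n.testBit i = true) m := by
  induction m with
  | zero => rfl
  | succ m ih =>
    have h : pop (m + 1) n = (n >>> m &&& 1) + pop m n := rfl
    rw [h, ih, Nat.count_succ, add_comm, Nat.and_one_is_mod, Nat.shiftRight_eq_div_pow,
      ← Nat.toNat_testBit]
    cases n.testBit m <;> simp

theorem ncard_eq_pop {α : Type*} {m : ℕ} {k : α → Fin m} (hk : Function.Injective k) {X : Set α}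
    {n : ℕ} (h : ∀ i : Fin m, n.testBit i = true ↔ ∃ e ∈ X, k e = i) : X.ncard = pop m n := by
  have hinj : Function.Injective fun e => (k e : ℕ) := Fin.val_injective.comp hk
  rw [pop_eq_count, Nat.count_eq_card_filter_range, ← Set.ncard_coe_finset,
    ← Set.ncard_image_of_injective X hinj]
  congr 1
  ext i
  simp only [Set.mem_image, Finset.coe_filter, Finset.mem_range, Set.mem_ofPred_eq]
  constructor
  · rintro ⟨e, he, rfl⟩
    exact ⟨(k e).2, (h (k e)).2 ⟨e, he, rfl⟩⟩
  · rintro ⟨hi, hn⟩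
    obtain ⟨e, he, hke⟩ := (h ⟨i, hi⟩).1 hn
    exact ⟨e, he, by rw [hke]⟩

theorem exists_mask (P : Fin 9 → Prop) :
    ∃ n < 512, ∀ i : Fin 9, n.testBit i = true ↔ P i := by
  classical
  refine ⟨Nat.ofBits fun i => decide (P i), Nat.ofBits_lt_two_pow _, fun i => ?_⟩
  rw [Nat.testBit_ofBits_lt _ _ i.2]
  simp

/-- The mask of a set of edges. -/
def mask (P : Fin 9 → Bool) : ℕ :=
  (List.finRange 9).foldr (fun (i : Fin 9) (acc : ℕ) =>
    (bif P i then 1 <<< (i : ℕ) else 0) ||| acc) 0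

theorem testBit_mask_iff_exists (P : Fin 9 → Bool) (n : ℕ) :
    (mask P).testBit n = true ↔ ∃ i : Fin 9, P i = true ∧ (i : ℕ) = n := by
  have key : ∀ l : List (Fin 9), (l.foldr (fun (i : Fin 9) (acc : ℕ) =>
      (bif P i then 1 <<< (i : ℕ) else 0) ||| acc) 0).testBit n = true ↔
      ∃ i ∈ l, P i = true ∧ (i : ℕ) = n := by
    intro l
    induction l with
    | nil => simp
    | cons i l ih =>
      rw [List.foldr_cons, Nat.testBit_or, Bool.or_eq_true, ih, List.exists_mem_cons_iff]
      refine or_congr ?_ Iff.rfl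
      cases P i
      · simp
      · simp [Nat.one_shiftLeft, Nat.testBit_two_pow]
  rw [mask, key]
  simp only [List.mem_finRange, true_and]

theorem testBit_mask (P : Fin 9 → Bool) (i : Fin 9) : (mask P).testBit i = true ↔ P i = true := by
  rw [testBit_mask_iff_exists]
  exact ⟨fun ⟨l, hl, h⟩ => Fin.ext h ▸ hl, fun h => ⟨i, h, rfl⟩⟩

/-- The mask of the edges incident with `v`, after renaming vertices along `r`. -/
def star (r : Fin 5 → Fin 5) (v : ℕ) : ℕ :=
  mask fun i => Nat.beq (r (lo i)) v || Nat.beq (r (hi i)) v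

theorem testBit_star (r : Fin 5 → Fin 5) (v : Fin 5) (i : Fin 9) :
    (star r v).testBit i = true ↔ v = r (lo i) ∨ v = r (hi i) := by
  rw [star, testBit_mask, Bool.or_eq_true, Nat.beq_eq, Nat.beq_eq, Fin.ext_iff, Fin.ext_iff,
    eq_comm, @eq_comm _ (v : ℕ) (r (hi i))]

theorem land_star_ne_zero (r : Fin 5 → Fin 5) (a : ℕ) (v : Fin 5) :
    Nat.land a (star r v) ≠ 0 ↔
      ∃ i : Fin 9, a.testBit i = true ∧ (v = r (lo i) ∨ v = r (hi i)) := by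
  change a &&& star r v ≠ 0 ↔ _
  constructor
  · intro h
    obtain ⟨n, hn⟩ := Nat.exists_testBit_of_ne_zero h
    rw [Nat.testBit_and, Bool.and_eq_true] at hn
    obtain ⟨i, -, rfl⟩ := (testBit_mask_iff_exists _ _).1 hn.2
    exact ⟨i, hn.1, (testBit_star r v i).1 hn.2⟩
  · rintro ⟨i, ha, hv⟩ h
    have h' : (a &&& star r v).testBit i = true := by
      rw [Nat.testBit_and, Bool.and_eq_true]
      exact ⟨ha, (testBit_star r v i).2 hv⟩
    simp [h] at h'

/-- The predicate of being incident with both `a` and `b`, after renaming vertices along `r`. -/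
def shared (r : Fin 5 → Fin 5) (a b : ℕ) (v : Fin 5) : Bool :=
  !Nat.beq (Nat.land a (star r v)) 0 && !Nat.beq (Nat.land b (star r v)) 0

/-- The order of the separation `(a, b)`, after renaming vertices along `r`. -/
def order (r : Fin 5 → Fin 5) (a b : ℕ) : ℕ :=
  (List.finRange 5).foldr (fun v n => Nat.add (shared r a b v).toNat n) 0

theorem order_eq_ncard (r : Fin 5 → Fin 5) (a b : ℕ) :
    order r a b = {v | shared r a b v = true}.ncard := by
  have h : order r a b = ∑ v, (shared r a b v).toNat := by
    simp only [Fin.sum_univ_five]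
    change (shared r a b 0).toNat + ((shared r a b 1).toNat + ((shared r a b 2).toNat +
      ((shared r a b 3).toNat + ((shared r a b 4).toNat + 0)))) = _
    ring
  rw [h, Set.ncard_eq_toFinset_card', Finset.card_eq_sum_ones]
  simp only [Set.toFinset_ofPred, Finset.sum_filter]
  refine Finset.sum_congr rfl fun v _ => ?_
  cases shared r a b v <;> simp

/-- The masks `a` inside `R` such that the separation `(a, R \ a)` has order at most two
and both sides have enough edges for it to be relevant. -/
def smallSeps (r : Fin 5 → Fin 5) (R : ℕ) : List ℕ :=
  (List.range 512).filter fun a => Nat.beq (Nat.land a R) a &&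
    Nat.ble (order r a (Nat.xor R a)) 2 &&
    Nat.ble (max 1 (order r a (Nat.xor R a))) (min (pop 9 a) (pop 9 (Nat.xor R a)))

/-- Boolean version of `Multigraph.badSplitSep` for the graph with edges `R` and
vertices renamed along `r`. -/
def hasBadSep (r : Fin 5 → Fin 5) (R s : ℕ) : Bool :=
  (smallSeps r R).any fun a =>
    (Nat.ble (order r a (Nat.xor R a)) 1 && Nat.ble 1 (pop 9 (Nat.land a s)) &&
        Nat.ble 1 (pop 9 (Nat.land (Nat.xor R a) s))) ||
      (Nat.beq (order r a (Nat.xor R a)) 2 &&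
        Nat.beq (min (pop 9 (Nat.land a s)) (pop 9 (Nat.land (Nat.xor R a) s))) 2)

theorem sepOrder_eq_order {G : Multigraph} {j : G.V → Fin 5} (hj : Function.Injective j)
    {k : G.E → Fin 9} {r : Fin 5 → Fin 5}
    (hlo : ∀ e, j (G.src e) = r (lo (k e))) (hhi : ∀ e, j (G.tgt e) = r (hi (k e)))
    {A : Set G.E} {a b : ℕ} (ha : ∀ i : Fin 9, a.testBit i = true ↔ ∃ e ∈ A, k e = i)
    (hb : ∀ i : Fin 9, b.testBit i = true ↔ ∃ e ∈ Aᶜ, k e = i) :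
    G.sepOrder A = order r a b := by
  have key : ∀ (X : Set G.E) (x : ℕ), (∀ i : Fin 9, x.testBit i = true ↔ ∃ e ∈ X, k e = i) →
      ∀ v : Fin 5, Nat.land x (star r v) ≠ 0 ↔ ∃ w ∈ G.edgeVerts X, j w = v := by
    intro X x hx v
    rw [land_star_ne_zero]
    constructor
    · rintro ⟨i, hi', hv⟩
      obtain ⟨e, he, rfl⟩ := (hx i).1 hi'
      rcases hv with rfl | rfl
      · exact ⟨G.src e, ⟨e, he, Or.inl rfl⟩, hlo e⟩
      · exact ⟨G.tgt e, ⟨e, he, Or.inr rfl⟩, hhi e⟩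
    · rintro ⟨w, ⟨e, he, rfl | rfl⟩, rfl⟩
      · exact ⟨k e, (hx _).2 ⟨e, he, rfl⟩, Or.inl (hlo e)⟩
      · exact ⟨k e, (hx _).2 ⟨e, he, rfl⟩, Or.inr (hhi e)⟩
  rw [order_eq_ncard, Multigraph.sepOrder, ← Set.ncard_image_of_injective _ hj]
  congr 1
  ext v
  have hv : shared r a b v = true ↔ Nat.land a (star r v) ≠ 0 ∧ Nat.land b (star r v) ≠ 0 := by
    rw [shared, Bool.and_eq_true, Bool.not_eq_true', Bool.not_eq_true', ← Bool.not_eq_true,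
      ← Bool.not_eq_true, Nat.beq_eq, Nat.beq_eq]
  rw [Set.mem_ofPred_eq, hv, key A a ha, key Aᶜ b hb, Set.image_inter hj]
  exact Iff.rfl

theorem badSplitSep_iff {G : Multigraph} {j : G.V → Fin 5} (hj : Function.Injective j)
    {k : G.E → Fin 9} (hk : Function.Injective k) {r : Fin 5 → Fin 5}
    (hlo : ∀ e, j (G.src e) = r (lo (k e))) (hhi : ∀ e, j (G.tgt e) = r (hi (k e)))
    {R : ℕ} (hR : ∀ i : Fin 9, R.testBit i = true ↔ ∃ e, k e = i)
    {S : Set G.E} {s : ℕ} (hS : ∀ e, e ∈ S ↔ s.testBit (k e) = true) :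
    G.badSplitSep S ↔ hasBadSep r R s = true := by
  have hinter : ∀ (X : Set G.E) (x : ℕ),
      (∀ i : Fin 9, x.testBit i = true ↔ ∃ e ∈ X, k e = i) → (X ∩ S).ncard = pop 9 (x &&& s) := by
    intro X x hx
    refine ncard_eq_pop hk fun i => ?_
    rw [Nat.testBit_and, Bool.and_eq_true, hx]
    constructor
    · rintro ⟨⟨e, he, rfl⟩, h⟩
      exact ⟨e, ⟨he, (hS e).2 h⟩, rfl⟩
    · rintro ⟨e, ⟨he, h⟩, rfl⟩
      exact ⟨⟨e, he, rfl⟩, (hS e).1 h⟩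
  have hcompl : ∀ (A : Set G.E) (a : ℕ),
      (∀ i : Fin 9, a.testBit i = true ↔ ∃ e ∈ A, k e = i) →
      ∀ i : Fin 9, (R ^^^ a).testBit i = true ↔ ∃ e ∈ Aᶜ, k e = i := by
    intro A a ha i
    have hsub : a.testBit i = true → R.testBit i = true := fun h => by
      obtain ⟨e, -, he⟩ := (ha i).1 h
      exact (hR i).2 ⟨e, he⟩
    have hxor : (R ^^^ a).testBit i = true ↔ R.testBit i = true ∧ ¬ a.testBit i = true := by
      rw [Nat.testBit_xor]
      revert hsub
      cases a.testBit i <;> cases R.testBit i <;> simp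
    rw [hxor, hR, ha]
    constructor
    · rintro ⟨⟨e, rfl⟩, h⟩
      exact ⟨e, fun he => h ⟨e, he, rfl⟩, rfl⟩
    · rintro ⟨e, he, rfl⟩
      exact ⟨⟨e, rfl⟩, fun ⟨e', he', h⟩ => he (hk h ▸ he')⟩
  have hbad : ∀ (A : Set G.E) (a : ℕ),
      (∀ i : Fin 9, a.testBit i = true ↔ ∃ e ∈ A, k e = i) →
      ((G.sepOrder A ≤ 1 ∧ (A ∩ S).Nonempty ∧ (Aᶜ ∩ S).Nonempty) ∨
        (G.sepOrder A = 2 ∧ min (A ∩ S).ncard (Aᶜ ∩ S).ncard = 2) ↔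
      (order r a (R ^^^ a) ≤ 1 ∧ 1 ≤ pop 9 (a &&& s) ∧ 1 ≤ pop 9 ((R ^^^ a) &&& s)) ∨
        (order r a (R ^^^ a) = 2 ∧ min (pop 9 (a &&& s)) (pop 9 ((R ^^^ a) &&& s)) = 2)) := by
    intro A a ha
    have hb := hcompl A a ha
    rw [← Set.ncard_pos (Set.toFinite _), ← Set.ncard_pos (Set.toFinite _), hinter A a ha,
      hinter Aᶜ _ hb, sepOrder_eq_order hj hlo hhi ha hb]
    exact Iff.rfl
  constructor
  · rintro ⟨A, hA⟩
    obtain ⟨a, ha512, ha⟩ := exists_mask fun i => ∃ e ∈ A, k e = i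
    rw [hbad A a ha] at hA
    have hsub : a &&& R = a := by
      refine Nat.eq_of_testBit_eq fun n => ?_
      rw [Nat.testBit_and]
      by_cases hn : n < 9
      · have h : a.testBit n = true → R.testBit n = true := fun h => by
          obtain ⟨e, -, he⟩ := (ha ⟨n, hn⟩).1 h
          exact (hR ⟨n, hn⟩).2 ⟨e, he⟩
        revert h
        cases a.testBit n <;> simp
      · have : a.testBit n = false :=
          Nat.testBit_lt_two_pow (lt_of_lt_of_le ha512 (Nat.pow_le_pow_right two_pos (not_lt.1 hn)))
        simp [this]
    refine List.any_eq_true.2 ⟨a, List.mem_filter.2 ⟨List.mem_range.2 ha512, ?_⟩, ?_⟩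
    · simp only [Bool.and_eq_true, Nat.beq_eq, Nat.ble_eq]
      have hle : ∀ (X : Set G.E) (x : ℕ),
          (∀ i : Fin 9, x.testBit i = true ↔ ∃ e ∈ X, k e = i) → pop 9 (x &&& s) ≤ pop 9 x := by
        intro X x hx
        rw [← hinter X x hx, ← ncard_eq_pop hk hx]
        exact Set.ncard_le_ncard Set.inter_subset_left (Set.toFinite _)
      have h₁ := hle A a ha
      have h₂ := hle Aᶜ _ (hcompl A a ha)
      change (a &&& R = a ∧ order r a (R ^^^ a) ≤ 2) ∧
        max 1 (order r a (R ^^^ a)) ≤ min (pop 9 a) (pop 9 (R ^^^ a))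
      exact ⟨⟨hsub, by omega⟩, by omega⟩
    · simp only [Bool.or_eq_true, Bool.and_eq_true, Nat.beq_eq, Nat.ble_eq, and_assoc]
      exact hA
  · intro h
    obtain ⟨a, ha, hA⟩ := List.any_eq_true.1 h
    have hsub := (List.mem_filter.1 ha).2
    simp only [Bool.and_eq_true, Nat.beq_eq, Nat.ble_eq] at hsub
    change (a &&& R = a ∧ _) ∧ _ at hsub
    refine ⟨{e | a.testBit (k e) = true}, (hbad _ a fun i => ?_).2 ?_⟩
    · constructor
      · intro hi'
        have hRi : R.testBit i = true := by
          have : (a &&& R).testBit i = true := by rw [hsub.1.1]; exact hi'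
          rw [Nat.testBit_and, Bool.and_eq_true] at this
          exact this.2
        obtain ⟨e, rfl⟩ := (hR i).1 hRi
        exact ⟨e, hi', rfl⟩
      · rintro ⟨e, he, rfl⟩
        exact he
    · simp only [Bool.or_eq_true, Bool.and_eq_true, Nat.beq_eq, Nat.ble_eq, and_assoc] at hA
      exact hA

/-- The mask of all edges except the `i`-th. -/
def allBut (i : Fin 9) : ℕ := 511 ^^^ (1 <<< (i : ℕ))

theorem testBit_allBut : ∀ i l : Fin 9, (allBut i).testBit l = true ↔ l ≠ i := by decide +kernel

/-- The vertex map that contracts the `i`-th edge. -/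
def contract (i : Fin 9) (v : Fin 5) : Fin 5 := bif v == hi i then lo i else v

theorem minorDC_badSplitSep_iff {D C : Set K5minusM.E} {f : K5minusM.E} (hDC : D ∪ C = {f})
    {r : Fin 5 → Fin 5} (hr : ∀ e ∈ C, r (K5minusM.src e) = r (K5minusM.tgt e))
    (hr' : ∀ a b : Fin 5, r a = r b → a = b ∨
      ∃ e ∈ C, (K5minusM.src e = a ∧ K5minusM.tgt e = b) ∨
        (K5minusM.src e = b ∧ K5minusM.tgt e = a))
    {S : Set K5minusM.E} {s : ℕ} (hS : ∀ e, e ∈ S ↔ s.testBit (idx e) = true) :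
    (K5minusM.minorDC D C).badSplitSep {e | e.1 ∈ S} ↔ hasBadSep r (allBut (idx f)) s = true := by
  refine badSplitSep_iff (G := K5minusM.minorDC D C)
    (j := Quot.lift r fun a b ⟨e, he, ha, hb⟩ => by rw [← ha, ← hb, hr e he])
    (k := fun e => idx e.1) ?_ (idx_injective.comp Subtype.val_injective)
    (fun e => congrArg r (src_eq e.1)) (fun e => congrArg r (tgt_eq e.1)) (fun i => ?_)
    (fun e => hS e.1)
  · rintro ⟨a⟩ ⟨b⟩ hab
    rcases hr' a b hab with rfl | ⟨e, he, ⟨ha, hb⟩ | ⟨ha, hb⟩⟩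
    · rfl
    · exact Quot.sound ⟨e, he, ha, hb⟩
    · exact (Quot.sound ⟨e, he, ha, hb⟩).symm
  · rw [testBit_allBut]
    constructor
    · intro h
      refine ⟨⟨edge i, ?_⟩, idx_edge i⟩
      rw [hDC]
      rintro rfl
      exact h (idx_edge i).symm
    · rintro ⟨e, rfl⟩ h
      exact e.2 (hDC.symm.subset (idx_injective h))

theorem badSplitSep_delete_iff (f : K5minusM.E) {S : Set K5minusM.E} {s : ℕ}
    (hS : ∀ e, e ∈ S ↔ s.testBit (idx e) = true) :
    (K5minusM.minorDC {f} ∅).badSplitSep {e | e.1 ∈ S} ↔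
      hasBadSep id (allBut (idx f)) s = true :=
  minorDC_badSplitSep_iff (Set.union_empty _) (fun _ h => h.elim) (fun _ _ h => Or.inl h) hS

theorem contract_eq_iff : ∀ i : Fin 9, contract i (lo i) = contract i (hi i) ∧
    ∀ a b : Fin 5, contract i a = contract i b →
      a = b ∨ (lo i = a ∧ hi i = b) ∨ (lo i = b ∧ hi i = a) := by
  decide +kernel

theorem badSplitSep_contract_iff (f : K5minusM.E) {S : Set K5minusM.E} {s : ℕ}
    (hS : ∀ e, e ∈ S ↔ s.testBit (idx e) = true) :
    (K5minusM.minorDC ∅ {f}).badSplitSep {e | e.1 ∈ S} ↔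
      hasBadSep (contract (idx f)) (allBut (idx f)) s = true := by
  refine minorDC_badSplitSep_iff (Set.empty_union _) ?_ (fun a b h => ?_) hS
  · rintro _ rfl
    rw [src_eq, tgt_eq]
    exact (contract_eq_iff _).1
  · refine ((contract_eq_iff _).2 a b h).imp id fun h => ⟨f, rfl, ?_⟩
    rwa [src_eq, tgt_eq]

theorem badSplitSep_self_iff {S : Set K5minusM.E} {s : ℕ}
    (hS : ∀ e, e ∈ S ↔ s.testBit (idx e) = true) :
    K5minusM.badSplitSep S ↔ hasBadSep id 511 s = true := by
  refine badSplitSep_iff (G := K5minusM) (j := id) (r := id)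
    Function.injective_id idx_injective
    src_eq tgt_eq (fun i => ?_) hS
  exact iff_of_true ((by decide +kernel : ∀ i : Fin 9, Nat.testBit 511 i = true) i)
    ⟨edge i, idx_edge i⟩

/-! ### The combinatorial conditions on masks -/

/-- The mask of the two endpoints of the `i`-th edge. -/
def endsMask (i : Fin 9) : ℕ := (1 <<< (lo i : ℕ)) ||| (1 <<< (hi i : ℕ))

/-- The edges `i`, `l`, `m` form a triangle. -/
def triangle (i l m : Fin 9) : Bool :=
  i != l && i != m && l != m && Nat.beq (pop 5 (endsMask i ||| endsMask l ||| endsMask m)) 3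

/-- The `i`-th edge is longitudinal. -/
def longitudinal (i : Fin 9) : Bool := Nat.ble 3 (hi i : ℕ)

/-- The `i`-th edge lies in a triangle whose other two edges belong to the mask `s`. -/
def inTriangle (s : ℕ) (i : Fin 9) : Bool :=
  (List.finRange 9).any fun l => s.testBit l &&
    (List.finRange 9).any fun m => s.testBit m && triangle i l m

/-- The mask of the triangle through the degree-three end of the longitudinal edge `i` that
avoids this edge. -/
def opposite (i : Fin 9) : ℕ :=
  mask fun l => lo l != lo i && hi l != lo i && (hi l == hi i || !longitudinal l)

/-- The masks of the 5-configurations. -/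
def configs : List ℕ := (List.range 512).filter fun s => Nat.beq (pop 9 s) 5

theorem hasBadSep_self_eq_false : (configs.all fun s => !hasBadSep id 511 s) = true := by
  decide +kernel

theorem hasBadSep_delete_eq :
    ((List.finRange 9).all fun i => configs.all fun s => !s.testBit i ||
      (hasBadSep id (allBut i) s ==
        (longitudinal i && Nat.ble 2 (pop 9 (Nat.land (opposite i) s))))) = true := by
  decide +kernel

theorem hasBadSep_contract_eq :
    ((List.finRange 9).all fun i => configs.all fun s => !s.testBit i ||
      (hasBadSep (contract i) (allBut i) s == (!longitudinal i || inTriangle s i))) = true := by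
  decide +kernel

theorem mem_configs {s : ℕ} (hs : s < 512) (h : pop 9 s = 5) : s ∈ configs :=
  List.mem_filter.2 ⟨List.mem_range.2 hs, by rw [Nat.beq_eq]; exact h⟩

/-! ### Translation of the conditions -/

theorem ends_eq (e : K5minusM.E) : K5minusM.ends e = s(lo (idx e), hi (idx e)) := by
  rw [Multigraph.ends, src_eq, tgt_eq]
  rfl

theorem degree_eq_three_iff (v : Fin 5) : K5minusM.degree v = 3 ↔ 3 ≤ (v : ℕ) := by
  have hcard : ∀ (g : K5minusM.E → Fin 5) (g' : Fin 9 → Fin 5), (∀ e, g e = g' (idx e)) →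
      ({e ∈ Set.univ | g e = v} : Set K5minusM.E).ncard = pop 9 (mask fun i => g' i == v) := by
    intro g g' hg
    refine ncard_eq_pop idx_injective fun i => ?_
    rw [testBit_mask, beq_iff_eq]
    constructor
    · intro h
      exact ⟨edge i, ⟨trivial, by rw [hg, idx_edge, h]⟩, idx_edge i⟩
    · rintro ⟨e, ⟨-, h⟩, rfl⟩
      rw [← hg, h]
  have hpop : ∀ v : Fin 5, pop 9 (mask fun i => lo i == v) + pop 9 (mask fun i => hi i == v) = 3 ↔
      3 ≤ (v : ℕ) := by
    decide +kernel
  rw [← hpop v, ← hcard K5minusM.src lo src_eq, ← hcard K5minusM.tgt hi tgt_eq]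
  exact Iff.rfl

theorem longitudinal_iff (e : K5minusM.E) :
    (∃ v : K5minusM.V, K5minusM.degree v = 3 ∧ K5minusM.inc v e) ↔
      longitudinal (idx e) = true := by
  have h : ∀ i : Fin 9, (∃ v : Fin 5, 3 ≤ (v : ℕ) ∧ (v = lo i ∨ v = hi i)) ↔
      longitudinal i = true := by
    decide +kernel
  rw [← h]
  refine exists_congr fun v => and_congr (degree_eq_three_iff v) ?_
  rw [Multigraph.inc, src_eq, tgt_eq]
  exact Iff.rfl

theorem triangle_iff : ∀ i l m : Fin 9, triangle i l m = true ↔ i ≠ l ∧ i ≠ m ∧ l ≠ m ∧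
    ∃ a b c : Fin 5, a ≠ b ∧ a ≠ c ∧ b ≠ c ∧
      s(lo i, hi i) = s(a, b) ∧ s(lo l, hi l) = s(b, c) ∧ s(lo m, hi m) = s(a, c) := by
  decide +kernel

theorem inTriangle_iff {S : Set K5minusM.E} {s : ℕ}
    (hS : ∀ e, e ∈ S ↔ s.testBit (idx e) = true) (e : K5minusM.E) :
    (∃ f ∈ S, ∃ g ∈ S, e ≠ f ∧ e ≠ g ∧ f ≠ g ∧
      ∃ a b c : K5minusM.V, a ≠ b ∧ a ≠ c ∧ b ≠ c ∧
        K5minusM.ends e = s(a, b) ∧ K5minusM.ends f = s(b, c) ∧ K5minusM.ends g = s(a, c)) ↔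
      inTriangle s (idx e) = true := by
  simp only [inTriangle, List.any_eq_true, List.mem_finRange, true_and, Bool.and_eq_true,
    triangle_iff]
  constructor
  · rintro ⟨f, hf, g, hg, hef, heg, hfg, h⟩
    simp only [ends_eq] at h
    exact ⟨idx f, (hS f).1 hf, idx g, (hS g).1 hg, idx_injective.ne hef, idx_injective.ne heg,
      idx_injective.ne hfg, h⟩
  · rintro ⟨l, hl, m, hm, hel, hem, hlm, h⟩
    refine ⟨edge l, (hS _).2 (by rwa [idx_edge]), edge m, (hS _).2 (by rwa [idx_edge]), ?_, ?_,
      edge_injective.ne hlm, ?_⟩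
    · rintro rfl
      exact hel (idx_edge l)
    · rintro rfl
      exact hem (idx_edge m)
    · simp only [ends_eq, idx_edge]
      exact h

set_option synthInstance.maxSize 1000 in
set_option synthInstance.maxHeartbeats 200000 in
theorem opposite_spec : ∀ (i : Fin 9) (u : Fin 5), (u = lo i ∨ u = hi i) → 3 ≤ (u : ℕ) →
    ∀ a b : Fin 5, u ≠ a → u ≠ b → a ≠ b →
      ∀ f : Fin 9, s(lo f, hi f) = s(u, a) → ∀ g : Fin 9, s(lo g, hi g) = s(u, b) →
        ∀ h : Fin 9, s(lo h, hi h) = s(a, b) → i ≠ f → i ≠ g → i ≠ h →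
          ∀ l : Fin 9, (opposite i).testBit l = true ↔ l = f ∨ l = g ∨ l = h := by
  decide +kernel

theorem exists_opposite : ∀ i : Fin 9, longitudinal i = true → 3 ≤ (hi i : ℕ) ∧
    ∃ a b : Fin 5, hi i ≠ a ∧ hi i ≠ b ∧ a ≠ b ∧ ∃ f : Fin 9, s(lo f, hi f) = s(hi i, a) ∧
      ∃ g : Fin 9, s(lo g, hi g) = s(hi i, b) ∧ ∃ h : Fin 9, s(lo h, hi h) = s(a, b) ∧
        i ≠ f ∧ i ≠ g ∧ i ≠ h := by
  decide +kernel

theorem ncard_triangle_inter {S : Set K5minusM.E} {s n : ℕ}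
    (hS : ∀ e, e ∈ S ↔ s.testBit (idx e) = true) {f g h : K5minusM.E}
    (hn : ∀ l : Fin 9, n.testBit l = true ↔ l = idx f ∨ l = idx g ∨ l = idx h) :
    (({f, g, h} : Set K5minusM.E) ∩ S).ncard = pop 9 (Nat.land n s) := by
  refine ncard_eq_pop idx_injective fun i => ?_
  change (n &&& s).testBit i = true ↔ _
  rw [Nat.testBit_and, Bool.and_eq_true, hn]
  constructor
  · rintro ⟨hi', hs⟩
    refine ⟨edge i, ⟨?_, (hS _).2 (by rwa [idx_edge])⟩, idx_edge i⟩
    rcases hi' with rfl | rfl | rfl <;> simp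
  · rintro ⟨e, ⟨he, heS⟩, rfl⟩
    refine ⟨?_, (hS e).1 heS⟩
    rcases he with rfl | rfl | rfl <;> simp

theorem opposite_iff {S : Set K5minusM.E} {s : ℕ}
    (hS : ∀ e, e ∈ S ↔ s.testBit (idx e) = true) (e : K5minusM.E) (P : Prop) :
    (∀ u : K5minusM.V, K5minusM.inc u e → K5minusM.degree u = 3 →
      ∀ f g h : K5minusM.E, ∀ a b : K5minusM.V, u ≠ a → u ≠ b → a ≠ b →
        K5minusM.ends f = s(u, a) → K5minusM.ends g = s(u, b) → K5minusM.ends h = s(a, b) →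
        e ≠ f → e ≠ g → e ≠ h → 2 ≤ (({f, g, h} : Set K5minusM.E) ∩ S).ncard → P) ↔
      ((longitudinal (idx e) && Nat.ble 2 (pop 9 (Nat.land (opposite (idx e)) s))) = true →
        P) := by
  rw [Bool.and_eq_true, Nat.ble_eq]
  constructor
  · rintro H ⟨hl, hp⟩
    obtain ⟨hu, a, b, hua, hub, hab, f, hf, g, hg, h, hh, hef, heg, heh⟩ := exists_opposite _ hl
    have hne : ∀ l, idx e ≠ l → e ≠ edge l := by
      rintro l hl rfl
      exact hl (idx_edge l)
    refine H (hi (idx e)) (Or.inr (tgt_eq e).symm) ((degree_eq_three_iff _).2 hu)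
      (edge f) (edge g) (edge h) a b hua hub hab (by rw [ends_eq, idx_edge]; exact hf)
      (by rw [ends_eq, idx_edge]; exact hg) (by rw [ends_eq, idx_edge]; exact hh)
      (hne _ hef) (hne _ heg) (hne _ heh) ?_
    rw [ncard_triangle_inter hS (n := opposite (idx e))]
    · exact hp
    · simp only [idx_edge]
      exact opposite_spec _ _ (Or.inr rfl) hu a b hua hub hab f hf g hg h hh hef heg heh
  · intro H u hu hdeg f g h a b hua hub hab hf hg hh hef heg heh hcard
    have hu3 := (degree_eq_three_iff u).1 hdeg
    refine H ⟨(longitudinal_iff e).1 ⟨u, hdeg, hu⟩, ?_⟩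
    rw [Multigraph.inc, src_eq, tgt_eq] at hu
    rw [ends_eq] at hf hg hh
    rwa [← ncard_triangle_inter hS (opposite_spec _ u hu hu3 a b hua hub hab _ hf _ hg _ hh
      (idx_injective.ne hef) (idx_injective.ne heg) (idx_injective.ne heh))]

end Masks

end K5minus

theorem stmt19 (Cp Dp : Set K5minusM.E) (S : Set K5minusM.E) (hS : S.ncard = 5) :
    ¬ (EGraph.mk K5minusM Cp Dp).Splits S ↔
      ((∀ e ∈ S, ¬ (∃ v : K5minusM.V, K5minusM.degree v = 3 ∧ K5minusM.inc v e) →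
          e ∈ Cp) ∧
        (∀ e ∈ S, (∃ v : K5minusM.V, K5minusM.degree v = 3 ∧ K5minusM.inc v e) →
          (∃ f ∈ S, ∃ g ∈ S, e ≠ f ∧ e ≠ g ∧ f ≠ g ∧
            ∃ a b c : K5minusM.V, a ≠ b ∧ a ≠ c ∧ b ≠ c ∧
              K5minusM.ends e = s(a, b) ∧ K5minusM.ends f = s(b, c) ∧
              K5minusM.ends g = s(a, c)) →
          e ∈ Cp) ∧
        (∀ e ∈ S, ∀ u : K5minusM.V, K5minusM.inc u e → K5minusM.degree u = 3 →
          ∀ f g h : K5minusM.E, ∀ a b : K5minusM.V,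
            u ≠ a → u ≠ b → a ≠ b →
            K5minusM.ends f = s(u, a) → K5minusM.ends g = s(u, b) →
            K5minusM.ends h = s(a, b) →
            e ≠ f → e ≠ g → e ≠ h →
            2 ≤ (({f, g, h} : Set K5minusM.E) ∩ S).ncard →
            e ∈ Dp)) := by
  obtain ⟨s, hs, hmask⟩ := K5minus.exists_mask fun i => K5minus.edge i ∈ S
  have hmem : ∀ e, e ∈ S ↔ s.testBit (K5minus.idx e) = true := fun e => by
    rw [hmask, K5minus.edge_idx]
  have hpop : K5minus.pop 9 s = 5 := by
    rw [← hS]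
    refine (K5minus.ncard_eq_pop K5minus.idx_injective fun i => ?_).symm
    rw [hmask]
    exact ⟨fun h => ⟨_, h, K5minus.idx_edge i⟩, fun ⟨e, he, h⟩ => by rwa [← h, K5minus.edge_idx]⟩
  have hconf := K5minus.mem_configs hs hpop
  have hself : ¬ K5minusM.badSplitSep S := by
    rw [K5minus.badSplitSep_self_iff hmem]
    simpa using List.all_eq_true.1 K5minus.hasBadSep_self_eq_false s hconf
  have hdel : ∀ e ∈ S, ((K5minusM.minorDC {e} ∅).badSplitSep {x | x.1 ∈ S} ↔
      (K5minus.longitudinal (K5minus.idx e) && Nat.ble 2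
        (K5minus.pop 9 (Nat.land (K5minus.opposite (K5minus.idx e)) s))) = true) := by
    intro e he
    have h := List.all_eq_true.1 (List.all_eq_true.1 K5minus.hasBadSep_delete_eq
      (K5minus.idx e) (List.mem_finRange _)) s hconf
    rw [(hmem e).1 he, Bool.not_true, Bool.false_or, beq_iff_eq] at h
    rw [K5minus.badSplitSep_delete_iff e hmem, h]
  have hcon : ∀ e ∈ S, ((K5minusM.minorDC ∅ {e}).badSplitSep {x | x.1 ∈ S} ↔
      (¬ K5minus.longitudinal (K5minus.idx e) = true ∨
        K5minus.inTriangle s (K5minus.idx e) = true)) := by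
    intro e he
    have h := List.all_eq_true.1 (List.all_eq_true.1 K5minus.hasBadSep_contract_eq
      (K5minus.idx e) (List.mem_finRange _)) s hconf
    rw [(hmem e).1 he, Bool.not_true, Bool.false_or, beq_iff_eq] at h
    rw [K5minus.badSplitSep_contract_iff e hmem, h, Bool.or_eq_true, Bool.not_eq_true',
      Bool.not_eq_true]
  simp only [K5minus.longitudinal_iff, K5minus.inTriangle_iff hmem, K5minus.opposite_iff hmem]
  constructor
  · intro H
    refine ⟨fun e he hl => ?_, fun e he _ ht => ?_, fun e he h => ?_⟩ <;> by_contra hP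
    · exact H (Or.inr (Or.inr ⟨e, ⟨he, hP⟩, (hcon e he).2 (Or.inl hl)⟩))
    · exact H (Or.inr (Or.inr ⟨e, ⟨he, hP⟩, (hcon e he).2 (Or.inr ht)⟩))
    · exact H (Or.inr (Or.inl ⟨e, ⟨he, hP⟩, (hdel e he).2 h⟩))
  · rintro ⟨h₁, h₂, h₃⟩ (h | ⟨e, ⟨he, hP⟩, h⟩ | ⟨e, ⟨he, hP⟩, h⟩)
    · exact hself h
    · exact hP (h₃ e he ((hdel e he).1 h))
    · by_cases hl : K5minus.longitudinal (K5minus.idx e) = true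
      · exact hP (h₂ e he hl (((hcon e he).1 h).resolve_left (not_not_intro hl)))
      · exact hP (h₁ e he hl)
end
end
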